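/- For every integer k ≥ 3 there exist constants C, c, α > 0 such that for all sufficiently large n and all p with p > C n^{-1/(k-1)}, the binomial random set [n]_p is (α,k)-rb with probability at least 1 − e^{−c n p}. -/

import Mathlib

/-- `A` contains the `k`-term arithmetic progression with first term `a` and
common difference `d ≥ 1`. -/
def APIn (k : ℕ) (A : Finset ℕ) (a d : ℕ) : Prop :=
  1 ≤ d ∧ ∀ i < k, a + i * d ∈ A

/-- The colouring `χ` is constant on the `k`-AP with first term `a` and difference `d`. -/
def MonoOn (k : ℕ) (χ : ℕ → ℕ) (a d : ℕ) : Prop :=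
  ∀ i < k, ∀ j < k, χ (a + i * d) = χ (a + j * d)

/-- The colouring `χ` is injective (rainbow) on the `k`-AP with first term `a`
and difference `d`. -/
def RainbowOn (k : ℕ) (χ : ℕ → ℕ) (a d : ℕ) : Prop :=
  ∀ i < k, ∀ j < k, i ≠ j → χ (a + i * d) ≠ χ (a + j * d)

/-- The colouring `χ` of `A` is `α`-bounded: every colour class has size at most `α|A|`. -/
def BddColoring (α : ℝ) (A : Finset ℕ) (χ : ℕ → ℕ) : Prop :=
  ∀ i : ℕ, ((A.filter fun a => χ a = i).card : ℝ) ≤ α * A.card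

/-- `A` is `(α,k)`-rb: every `α`-bounded colouring of `A` admits a rainbow `k`-AP in `A`. -/
def IsRb (α : ℝ) (k : ℕ) (A : Finset ℕ) : Prop :=
  ∀ χ : ℕ → ℕ, BddColoring α A χ → ∃ a d : ℕ, APIn k A a d ∧ RainbowOn k χ a d

open scoped Classical in
/-- The probability that the binomial random subset `[n]_p` of `{1,…,n}` (each element kept
independently with probability `p`) satisfies the predicate `P`. -/
noncomputable def binomProb (n : ℕ) (p : ℝ) (P : Finset ℕ → Prop) : ℝ :=
  ∑ A ∈ (Finset.Icc 1 n).powerset,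
    if P A then p ^ A.card * (1 - p) ^ (n - A.card) else 0

section Containers

variable {V : Type*} [DecidableEq V]

/-- The number of tuples of `G` that agree with `y` on the coordinates in `J`. -/
def tupleDeg {s : ℕ} (G : Finset (Fin s → V)) (J : Finset (Fin s)) (y : Fin s → V) : ℕ :=
  (G.filter fun e => ∀ i ∈ J, e i = y i).card

/-- Fixing the coordinates in a nonempty set `J` leaves at most `K * D ^ (s - |J|)` tuples. -/
def DegBound {s : ℕ} (K D : ℝ) (G : Finset (Fin s → V)) : Prop :=
  ∀ J : Finset (Fin s), J.Nonempty → ∀ y : Fin s → V,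
    (tupleDeg G J y : ℝ) ≤ K * D ^ (s - J.card)

/-- The tuples obtained by deleting a last coordinate in `S` from a tuple of `G`. -/
def linkSet {s : ℕ} (G : Finset (Fin (s + 1) → V)) (S : Finset V) : Finset (Fin s → V) :=
  (G.filter fun e => e (Fin.last s) ∈ S).image fun e i => e i.castSucc

omit [DecidableEq V] in
lemma tuple_ext_last {s : ℕ} {e e' : Fin (s + 1) → V}
    (h : (fun i : Fin s => e i.castSucc) = fun i => e' i.castSucc)
    (hl : e (Fin.last s) = e' (Fin.last s)) : e = e' := by
  funext i
  refine Fin.lastCases hl (fun j => congrFun h j) i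

lemma linkSet_mono {s : ℕ} (G : Finset (Fin (s + 1) → V)) {S T : Finset V} (h : S ⊆ T) :
    linkSet G S ⊆ linkSet G T := by
  unfold linkSet
  refine Finset.image_subset_image fun e he => ?_
  rw [Finset.mem_filter] at he ⊢
  exact ⟨he.1, h he.2⟩

lemma tupleDeg_union_le {s : ℕ} (F U : Finset (Fin s → V)) (J : Finset (Fin s))
    (y : Fin s → V) : tupleDeg (F ∪ U) J y ≤ tupleDeg F J y + tupleDeg U J y := by
  unfold tupleDeg
  rw [Finset.filter_union]
  exact Finset.card_union_le _ _

lemma tupleDeg_congr {s : ℕ} (F : Finset (Fin s → V)) (J : Finset (Fin s))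
    {x y : Fin s → V} (h : ∀ i ∈ J, x i = y i) : tupleDeg F J x = tupleDeg F J y := by
  unfold tupleDeg
  congr 1
  refine Finset.filter_congr fun e _ => ?_
  exact forall₂_congr fun i hi => by rw [h i hi]

/-- Agreement on the initial coordinates in `J` is controlled by the degrees of `G`. -/
lemma card_init_agree_le {s : ℕ} {K D : ℝ} {G : Finset (Fin (s + 1) → V)} (hG : DegBound K D G)
    {J : Finset (Fin s)} (hJ : J.Nonempty) (x : Fin s → V) (hx : 0 ≤ K * D ^ (s + 1 - J.card)) :
    ((G.filter fun e => ∀ i ∈ J, x i = e i.castSucc).card : ℝ) ≤ K * D ^ (s + 1 - J.card) := by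
  rcases Finset.eq_empty_or_nonempty (G.filter fun e => ∀ i ∈ J, x i = e i.castSucc) with h | h
  · rw [h]; simpa using hx
  · obtain ⟨e₀, he₀⟩ := h
    rw [Finset.mem_filter] at he₀
    have := hG (J.map Fin.castSuccEmb) (by simpa using hJ) e₀
    rw [Finset.card_map] at this
    refine le_trans ?_ this
    unfold tupleDeg
    norm_cast
    refine Finset.card_le_card fun e he => ?_
    rw [Finset.mem_filter] at he ⊢
    refine ⟨he.1, ?_⟩
    simp only [Finset.mem_map, forall_exists_index, and_imp]
    rintro _ j hj rfl
    simp only [Fin.coe_castSuccEmb]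
    rw [← he.2 j hj, ← he₀.2 j hj]

lemma DegBound.link_singleton {s : ℕ} {K D : ℝ} {G : Finset (Fin (s + 1) → V)}
    (hG : DegBound K D G) (v : V) : DegBound K D (linkSet G {v}) := by
  intro J hJ y
  have h := hG (insert (Fin.last s) (J.map Fin.castSuccEmb)) (by simp) (Fin.snoc y v)
  have hc : (insert (Fin.last s) (J.map Fin.castSuccEmb)).card = J.card + 1 := by
    rw [Finset.card_insert_of_notMem, Finset.card_map]
    simp only [Finset.mem_map, not_exists, not_and]
    intro j _ hj
    exact (Fin.castSucc_lt_last j).ne hj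
  rw [hc, Nat.add_sub_add_right] at h
  refine le_trans ?_ h
  unfold tupleDeg linkSet
  norm_cast
  rw [Finset.filter_image, Finset.filter_filter]
  refine Finset.card_image_le.trans (Finset.card_le_card fun e he => ?_)
  rw [Finset.mem_filter] at he ⊢
  refine ⟨he.1, ?_⟩
  simp only [Finset.mem_singleton] at he
  intro i hi
  rw [Finset.mem_insert] at hi
  rcases hi with rfl | hi
  · simpa using he.2.1
  · obtain ⟨j, hj, rfl⟩ := Finset.mem_map.1 hi
    simpa using he.2.2 j hj

/-- The tuples in the link of `v` that contain no saturated pattern can all be added. -/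
lemma DegBound.union_unsaturated {s : ℕ} {K D : ℝ} {U F : Finset (Fin s → V)}
    (hU : DegBound K D U) (hF : DegBound (K + 1) D F)
    (hUF : ∀ x ∈ U, ∀ J : Finset (Fin s), J.Nonempty → (tupleDeg F J x : ℝ) < D ^ (s - J.card)) :
    DegBound (K + 1) D (F ∪ U) := by
  intro J hJ y
  have hun : (tupleDeg (F ∪ U) J y : ℝ) ≤ tupleDeg F J y + tupleDeg U J y := by
    exact_mod_cast tupleDeg_union_le F U J y
  rcases Finset.eq_empty_or_nonempty (U.filter fun e => ∀ i ∈ J, e i = y i) with h | h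
  · have : tupleDeg U J y = 0 := by unfold tupleDeg; rw [h]; rfl
    rw [this] at hun
    have := hF J hJ y
    push_cast at hun
    linarith
  · obtain ⟨x, hx⟩ := h
    rw [Finset.mem_filter] at hx
    have h1 := hUF x hx.1 J hJ
    rw [tupleDeg_congr F J hx.2] at h1
    have h2 := hU J hJ y
    linarith

lemma DegBound.mono {s : ℕ} {K D : ℝ} {U W : Finset (Fin s → V)} (h : DegBound K D W)
    (hUW : U ⊆ W) : DegBound K D U := fun J hJ y =>
  le_trans (by
    unfold tupleDeg
    exact_mod_cast Finset.card_le_card (Finset.filter_subset_filter _ hUW)) (h J hJ y)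

/-- Few tuples of `G` contain a pattern saturated by `F`. -/
lemma card_saturated_le {s : ℕ} {K D : ℝ} (hK : 0 ≤ K) (hD : 0 < D)
    {G : Finset (Fin (s + 1) → V)} (hG : DegBound K D G) (F : Finset (Fin s → V)) :
    ((G.filter fun e => ∃ J : Finset (Fin s), J.Nonempty ∧
      D ^ (s - J.card) ≤ (tupleDeg F J fun i => e i.castSucc : ℝ)).card : ℝ)
      ≤ 2 ^ s * (K * D * F.card) := by
  classical
  have hone : ∀ J : Finset (Fin s), J.Nonempty →
      ((G.filter fun e => D ^ (s - J.card) ≤ (tupleDeg F J fun i => e i.castSucc : ℝ)).card : ℝ)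
        ≤ K * D * F.card := by
    intro J hJ
    set Q := G.filter fun e => D ^ (s - J.card) ≤ (tupleDeg F J fun i => e i.castSucc : ℝ)
    have hJs : J.card ≤ s := by simpa using Finset.card_le_univ J
    have hpos : 0 < D ^ (s - J.card) := by positivity
    have h1 : (Q.card : ℝ) * D ^ (s - J.card)
        ≤ ∑ e ∈ Q, (tupleDeg F J fun i => e i.castSucc : ℝ) := by
      rw [← nsmul_eq_mul]
      exact Finset.card_nsmul_le_sum _ _ _ fun e he => (Finset.mem_filter.1 he).2
    have h2 : (∑ e ∈ Q, (tupleDeg F J fun i => e i.castSucc : ℝ))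
        = ∑ x ∈ F, ((Q.filter fun e => ∀ i ∈ J, x i = e i.castSucc).card : ℝ) := by
      unfold tupleDeg
      exact_mod_cast Finset.sum_card_bipartiteAbove_eq_sum_card_bipartiteBelow
        (s := Q) (t := F) (fun e x => ∀ i ∈ J, x i = e i.castSucc)
    have h3 : (∑ x ∈ F, ((Q.filter fun e => ∀ i ∈ J, x i = e i.castSucc).card : ℝ))
        ≤ ∑ _x ∈ F, K * D ^ (s + 1 - J.card) := by
      refine Finset.sum_le_sum fun x _ => ?_
      refine le_trans ?_ (card_init_agree_le hG hJ x (by positivity))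
      exact_mod_cast Finset.card_le_card
        (Finset.filter_subset_filter _ (Finset.filter_subset _ _))
    rw [Finset.sum_const, nsmul_eq_mul, Nat.succ_sub hJs, pow_succ] at h3
    have h4 : (Q.card : ℝ) * D ^ (s - J.card) ≤ K * D * F.card * D ^ (s - J.card) := by
      calc _ ≤ _ := h1.trans (h2.le.trans h3)
        _ = _ := by ring
    exact le_of_mul_le_mul_right h4 hpos
  have hsub : (G.filter fun e => ∃ J : Finset (Fin s), J.Nonempty ∧
      D ^ (s - J.card) ≤ (tupleDeg F J fun i => e i.castSucc : ℝ)) ⊆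
      (Finset.univ.filter fun J : Finset (Fin s) => J.Nonempty).biUnion fun J =>
        G.filter fun e => D ^ (s - J.card) ≤ (tupleDeg F J fun i => e i.castSucc : ℝ) := by
    intro e he
    rw [Finset.mem_filter] at he
    obtain ⟨he, J, hJ, h⟩ := he
    simp only [Finset.mem_biUnion, Finset.mem_filter, Finset.mem_univ, true_and]
    exact ⟨J, hJ, he, h⟩
  calc _ ≤ ((((Finset.univ.filter fun J : Finset (Fin s) => J.Nonempty).biUnion fun J =>
        G.filter fun e => D ^ (s - J.card) ≤ (tupleDeg F J fun i => e i.castSucc : ℝ)).card : ℕ)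
          : ℝ) := by exact_mod_cast Finset.card_le_card hsub
    _ ≤ ∑ J ∈ Finset.univ.filter fun J : Finset (Fin s) => J.Nonempty,
        ((G.filter fun e => D ^ (s - J.card) ≤
          (tupleDeg F J fun i => e i.castSucc : ℝ)).card : ℝ) := by
        exact_mod_cast Finset.card_biUnion_le
    _ ≤ ∑ _J ∈ Finset.univ.filter fun J : Finset (Fin s) => J.Nonempty, K * D * F.card :=
        Finset.sum_le_sum fun J hJ => hone J (Finset.mem_filter.1 hJ).2
    _ ≤ 2 ^ s * (K * D * F.card) := by
        rw [Finset.sum_const, nsmul_eq_mul]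
        have : ((Finset.univ.filter fun J : Finset (Fin s) => J.Nonempty).card : ℝ) ≤ 2 ^ s := by
          have := Finset.card_filter_le (Finset.univ : Finset (Finset (Fin s)))
            (fun J => J.Nonempty)
          rw [Finset.card_univ, Fintype.card_finset, Fintype.card_fin] at this
          exact_mod_cast this
        gcongr

/-- Every set `S` has a largest bounded-degree subfamily of its link. -/
lemma exists_max_bounded_link {s : ℕ} {K D : ℝ} (hK : 0 ≤ K) (hD : 0 ≤ D)
    (G : Finset (Fin (s + 1) → V)) (S : Finset V) :
    ∃ F : Finset (Fin s → V), F ⊆ linkSet G S ∧ DegBound K D F ∧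
      ∀ F' : Finset (Fin s → V), F' ⊆ linkSet G S → DegBound K D F' → F'.card ≤ F.card := by
  classical
  obtain ⟨F, hF, hmax⟩ := Finset.exists_max_image
    ((linkSet G S).powerset.filter fun F => DegBound K D F) Finset.card
    ⟨∅, by
      simp only [Finset.mem_filter, Finset.empty_mem_powerset, true_and]
      intro J hJ y
      simp only [tupleDeg, Finset.filter_empty, Finset.card_empty, Nat.cast_zero]
      positivity⟩
  rw [Finset.mem_filter, Finset.mem_powerset] at hF
  refine ⟨F, hF.1, hF.2, fun F' h1 h2 => hmax F' ?_⟩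
  rw [Finset.mem_filter, Finset.mem_powerset]
  exact ⟨h1, h2⟩

/-- If adding `v` increases the best bounded link by at most `μ`, then `v` lies in at most `μ`
unsaturated tuples as a last coordinate. -/
lemma card_unsaturated_le {s : ℕ} (hs : 1 ≤ s) {K D μ : ℝ}
    {G : Finset (Fin (s + 1) → V)} (hG : DegBound K D G) {S : Finset V} {v : V}
    {F : Finset (Fin s → V)} (hFS : F ⊆ linkSet G S) (hF : DegBound (K + 1) D F)
    (hμ : ∀ F' : Finset (Fin s → V), F' ⊆ linkSet G (insert v S) → DegBound (K + 1) D F' →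
      (F'.card : ℝ) ≤ F.card + μ) :
    (((G.filter fun e => ¬ ∃ J : Finset (Fin s), J.Nonempty ∧
      D ^ (s - J.card) ≤ (tupleDeg F J fun i => e i.castSucc : ℝ)).filter
        fun e => e (Fin.last s) = v).card : ℝ) ≤ μ := by
  classical
  set Q := (G.filter fun e => ¬ ∃ J : Finset (Fin s), J.Nonempty ∧
      D ^ (s - J.card) ≤ (tupleDeg F J fun i => e i.castSucc : ℝ)).filter
        fun e => e (Fin.last s) = v with hQ
  set U := Q.image fun e (i : Fin s) => e i.castSucc with hU
  have hcard : U.card = Q.card := by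
    refine Finset.card_image_of_injOn fun e he e' he' h => tuple_ext_last h ?_
    rw [(Finset.mem_filter.1 he).2, (Finset.mem_filter.1 he').2]
  have hUlink : U ⊆ linkSet G {v} := by
    refine Finset.image_subset_image fun e he => ?_
    simp only [hQ, Finset.mem_filter] at he
    simp only [Finset.mem_filter, Finset.mem_singleton]
    exact ⟨he.1.1, he.2⟩
  have hsat : ∀ x ∈ U, ∀ J : Finset (Fin s), J.Nonempty →
      (tupleDeg F J x : ℝ) < D ^ (s - J.card) := by
    intro x hx J hJ
    obtain ⟨e, he, rfl⟩ := Finset.mem_image.1 hx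
    simp only [hQ, Finset.mem_filter, not_exists, not_and, not_le] at he
    exact he.1.2 J hJ
  have hdisj : Disjoint F U := by
    rw [Finset.disjoint_right]
    intro x hx hxF
    have := hsat x hx Finset.univ ⟨⟨0, hs⟩, Finset.mem_univ _⟩
    simp only [Finset.card_univ, Fintype.card_fin, Nat.sub_self, pow_zero] at this
    have h0 : tupleDeg F Finset.univ x = 0 := by
      have : tupleDeg F Finset.univ x < 1 := by exact_mod_cast this
      omega
    unfold tupleDeg at h0
    rw [Finset.card_eq_zero] at h0
    have : x ∈ F.filter fun e => ∀ i ∈ Finset.univ, e i = x i := by simp [hxF]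
    rw [h0] at this
    simp at this
  have h := hμ (F ∪ U) (Finset.union_subset
      (hFS.trans (linkSet_mono G (Finset.subset_insert v S)))
      (hUlink.trans (linkSet_mono G (by simp))))
    (((hG.link_singleton v).mono hUlink).union_unsaturated hF hsat)
  rw [Finset.card_union_of_disjoint hdisj, hcard] at h
  push_cast at h
  linarith

lemma card_le_of_degBound {s : ℕ} {K D : ℝ} {F : Finset (Fin (s + 1) → V)} (hF : DegBound K D F)
    (i : Fin (s + 1)) {Q : Finset V} (hFQ : ∀ e ∈ F, e i ∈ Q) :
    (F.card : ℝ) ≤ Q.card * (K * D ^ s) := by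
  rw [Finset.card_eq_sum_card_fiberwise (f := fun e => e i) (t := Q) fun e he => hFQ e he]
  push_cast
  rw [← nsmul_eq_mul]
  refine Finset.sum_le_card_nsmul _ _ _ fun v _ => ?_
  have := hF {i} (by simp) (fun _ => v)
  simpa [tupleDeg] using this

/-- One container step: from a hypergraph of bounded degrees with many tuples, one finds, for
every independent set, a large set of vertices disjoint from it and determined by a few small
subsets of it. -/
theorem exists_container_step (s : ℕ) : ∀ K c R : ℝ, 0 < K → 0 < c → 0 < R →
    ∃ δ B : ℝ, 0 < δ ∧ 0 < B ∧ ∀ D n : ℝ, 0 < D → 0 < n → ∀ W : Finset V, (W.card : ℝ) ≤ R * n →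
      ∀ G : Finset (Fin (s + 1) → V), (∀ e ∈ G, ∀ i, e i ∈ W) → DegBound K D G →
        c * n * D ^ s ≤ G.card →
        ∃ X : (Fin s → Finset V) → Finset V, (∀ T, X T ⊆ W ∧ δ * n ≤ (X T).card) ∧
          ∀ I : Finset V, (∀ e ∈ G, ¬ ∀ i, e i ∈ I) →
            ∃ T, (∀ i, T i ⊆ I ∧ ((T i).card : ℝ) ≤ B * (n / D)) ∧ Disjoint (X T) I := by
  classical
  induction s with
  | zero =>
    intro K c R hK hc hR
    refine ⟨c, 1, hc, one_pos, fun D n hD hn W hW G hGW hG hGc => ?_⟩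
    refine ⟨fun _ => G.image fun e => e 0, fun _ => ⟨?_, ?_⟩, fun I hI => ?_⟩
    · intro v hv
      obtain ⟨e, he, rfl⟩ := Finset.mem_image.1 hv
      exact hGW e he 0
    · rw [Finset.card_image_of_injOn]
      · simpa using hGc
      · intro e _ e' _ h
        funext i
        rw [Fin.fin_one_eq_zero i]
        exact h
    · refine ⟨fun _ => ∅, fun i => i.elim0, ?_⟩
      rw [Finset.disjoint_left]
      intro v hv hvI
      obtain ⟨e, he, rfl⟩ := Finset.mem_image.1 hv
      refine hI e he fun i => ?_
      rw [Fin.fin_one_eq_zero i]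
      exact hvI
  | succ s ih =>
    intro K c R hK hc hR
    obtain ⟨δ', B', hδ', hB', IH⟩ := ih (K + 1) (c / (4 * (2 ^ (s + 1) * K))) R (by positivity)
      (by positivity) hR
    set c' := c / (4 * (2 ^ (s + 1) * K)) with hc'
    set β := c / (4 * R) with hβ
    have hβ0 : 0 < β := by positivity
    refine ⟨min δ' (c / (2 * K)), max B' (R * (K + 1) / β), by positivity, by positivity,
      fun D n hD hn W hW G hGW hG hGc => ?_⟩
    choose F hFlink hFdeg hFmax using
      exists_max_bounded_link (K := K + 1) (D := D) (by positivity) hD.le G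
    have hFW : ∀ S, ∀ e ∈ F S, ∀ i, e i ∈ W := by
      intro S x hx i
      obtain ⟨e, he, rfl⟩ := Finset.mem_image.1 (hFlink S hx)
      exact hGW e (Finset.mem_filter.1 he).1 _
    have hIH : ∀ S, ∃ X : (Fin s → Finset V) → Finset V, c' * n * D ^ s ≤ (F S).card →
        (∀ T, X T ⊆ W ∧ δ' * n ≤ (X T).card) ∧
          ∀ I : Finset V, (∀ e ∈ F S, ¬ ∀ i, e i ∈ I) →
            ∃ T, (∀ i, T i ⊆ I ∧ ((T i).card : ℝ) ≤ B' * (n / D)) ∧ Disjoint (X T) I := by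
      intro S
      by_cases h : c' * n * D ^ s ≤ (F S).card
      · obtain ⟨X, hX⟩ := IH D n hD hn W hW (F S) (hFW S) (hFdeg S) h
        exact ⟨X, fun _ => hX⟩
      · exact ⟨fun _ => ∅, fun h' => absurd h' h⟩
    choose Y hY using hIH
    set μ := β * D ^ (s + 1) with hμ
    have hμ0 : 0 < μ := by positivity
    set Z : Finset V → Finset V := fun S =>
      W.filter fun v => ¬ ((F (insert v S)).card : ℝ) ≤ (F S).card + μ with hZ
    have hZcard : ∀ S, ¬ c' * n * D ^ s ≤ (F S).card → c / (2 * K) * n ≤ (Z S).card := by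
      intro S hS
      set sat : (Fin (s + 2) → V) → Prop := fun e => ∃ J : Finset (Fin (s + 1)), J.Nonempty ∧
        D ^ (s + 1 - J.card) ≤ (tupleDeg (F S) J fun i => e i.castSucc : ℝ) with hsat
      have h1 : ((G.filter sat).card : ℝ) ≤ 2 ^ (s + 1) * (K * D * (F S).card) :=
        card_saturated_le hK.le hD hG (F S)
      have h2 : (((G.filter fun e => ¬ sat e).filter fun e => e (Fin.last _) ∉ Z S).card : ℝ)
          ≤ R * n * μ := by
        have hmaps : ∀ e ∈ (G.filter fun e => ¬ sat e).filter fun e => e (Fin.last _) ∉ Z S,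
            e (Fin.last _) ∈ W \ Z S := by
          intro e he
          simp only [Finset.mem_filter] at he
          exact Finset.mem_sdiff.2 ⟨hGW e he.1.1 _, he.2⟩
        rw [Finset.card_eq_sum_card_fiberwise (f := fun e : Fin (s + 2) → V => e (Fin.last _))
          (t := W \ Z S) fun e he => hmaps e he]
        push_cast
        have : ∀ v ∈ W \ Z S, ((((G.filter fun e => ¬ sat e).filter
            fun e => e (Fin.last _) ∉ Z S).filter fun e => e (Fin.last _) = v).card : ℝ) ≤ μ := by
          intro v hv
          rw [Finset.mem_sdiff] at hv
          have hv2 : ((F (insert v S)).card : ℝ) ≤ (F S).card + μ := by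
            by_contra hcon
            exact hv.2 (Finset.mem_filter.2 ⟨hv.1, hcon⟩)
          refine le_trans ?_ (card_unsaturated_le (μ := μ) (v := v) (by omega) hG (hFlink S)
            (hFdeg S)
            fun F' hF' hd => le_trans (by exact_mod_cast hFmax _ F' hF' hd) hv2)
          exact_mod_cast Finset.card_le_card
            (Finset.filter_subset_filter _ (Finset.filter_subset _ _))
        refine (Finset.sum_le_card_nsmul _ _ _ this).trans ?_
        rw [nsmul_eq_mul]
        gcongr
        exact le_trans (by exact_mod_cast Finset.card_le_card Finset.sdiff_subset) hW
      have h3 : ((G.filter fun e => e (Fin.last _) ∈ Z S).card : ℝ)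
          ≤ (Z S).card * (K * D ^ (s + 1)) :=
        card_le_of_degBound (hG.mono (Finset.filter_subset _ _)) (Fin.last _)
          fun e he => (Finset.mem_filter.1 he).2
      have hcover : (G.card : ℝ) ≤ (G.filter sat).card
          + ((G.filter fun e => ¬ sat e).filter fun e => e (Fin.last _) ∉ Z S).card
          + (G.filter fun e => e (Fin.last _) ∈ Z S).card := by
        have : G ⊆ (G.filter sat ∪ (G.filter fun e => ¬ sat e).filter
            fun e => e (Fin.last _) ∉ Z S) ∪ G.filter fun e => e (Fin.last _) ∈ Z S := by
          intro e he
          simp only [Finset.mem_union, Finset.mem_filter]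
          tauto
        have := (Finset.card_le_card this).trans ((Finset.card_union_le _ _).trans
          (Nat.add_le_add_right (Finset.card_union_le _ _) _))
        exact_mod_cast this
      have h4 : 2 ^ (s + 1) * (K * D * (F S).card) ≤ c / 4 * n * D ^ (s + 1) := by
        have hS' : ((F S).card : ℝ) ≤ c' * n * D ^ s := (not_le.1 hS).le
        calc 2 ^ (s + 1) * (K * D * (F S).card) ≤ 2 ^ (s + 1) * (K * D * (c' * n * D ^ s)) := by
              gcongr
          _ = c / 4 * n * D ^ (s + 1) := by rw [hc', pow_succ D]; field_simp
      have h5 : R * n * μ = c / 4 * n * D ^ (s + 1) := by rw [hμ, hβ]; field_simp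
      have h6 : c / 2 * n * D ^ (s + 1) ≤ (Z S).card * (K * D ^ (s + 1)) := by linarith
      have h7 : c / 2 * n ≤ (Z S).card * K := by
        have : 0 < D ^ (s + 1) := by positivity
        refine le_of_mul_le_mul_right (h6.trans (le_of_eq ?_)) this
        ring
      calc c / (2 * K) * n = c / 2 * n / K := by field_simp
        _ ≤ _ := by rw [div_le_iff₀ hK]; exact h7
    refine ⟨fun T => if c' * n * D ^ s ≤ (F (T 0)).card then Y (T 0) (Fin.tail T) else Z (T 0),
      fun T => ?_, fun I hI => ?_⟩
    · dsimp only
      split_ifs with h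
      · have := (hY (T 0) h).1 (Fin.tail T)
        exact ⟨this.1, le_trans (by gcongr; exact min_le_left _ _) this.2⟩
      · exact ⟨Finset.filter_subset _ _, le_trans (by gcongr; exact min_le_right _ _) (hZcard _ h)⟩
    · obtain ⟨S, hSI, hSmax⟩ := Finset.exists_max_image I.powerset
        (fun S => ((F S).card : ℝ) - μ * S.card) ⟨∅, by simp⟩
      rw [Finset.mem_powerset] at hSI
      have hScard : (S.card : ℝ) ≤ max B' (R * (K + 1) / β) * (n / D) := by
        have h0 := hSmax ∅ (by simp)
        simp only [Finset.card_empty, Nat.cast_zero, mul_zero, sub_zero] at h0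
        have h1 : ((F S).card : ℝ) ≤ W.card * ((K + 1) * D ^ s) :=
          card_le_of_degBound (hFdeg S) 0 fun e he => hFW S e he 0
        have h2 : (W.card : ℝ) * ((K + 1) * D ^ s) ≤ R * n * ((K + 1) * D ^ s) := by gcongr
        have h3 : μ * S.card ≤ R * n * ((K + 1) * D ^ s) := by
          have : (0 : ℝ) ≤ (F ∅).card := Nat.cast_nonneg _
          linarith
        calc (S.card : ℝ) ≤ R * n * ((K + 1) * D ^ s) / μ := by
              rw [le_div_iff₀ hμ0]; linarith
          _ = R * (K + 1) / β * (n / D) := by rw [hμ, pow_succ]; field_simp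
          _ ≤ _ := by gcongr; exact le_max_right _ _
      by_cases h : c' * n * D ^ s ≤ (F S).card
      · have hind : ∀ x ∈ F S, ¬ ∀ i, x i ∈ I := by
          intro x hx hxI
          obtain ⟨e, he, rfl⟩ := Finset.mem_image.1 (hFlink S hx)
          rw [Finset.mem_filter] at he
          exact hI e he.1 fun i => Fin.lastCases (hSI he.2) (fun j => hxI j) i
        obtain ⟨T, hT, hdisj⟩ := (hY S h).2 I hind
        refine ⟨Fin.cons S T, fun i => ?_, ?_⟩
        · refine Fin.cases ⟨hSI, hScard⟩ (fun j => ?_) i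
          rw [Fin.cons_succ]
          exact ⟨(hT j).1, (hT j).2.trans (by gcongr; exact le_max_left _ _)⟩
        · simp only [Fin.cons_zero, Fin.tail_cons]
          rw [if_pos h]
          exact hdisj
      · refine ⟨Fin.cons S fun _ => ∅, fun i => ?_, ?_⟩
        · refine Fin.cases ⟨hSI, hScard⟩ (fun j => ?_) i
          rw [Fin.cons_succ]
          refine ⟨by simp, ?_⟩
          rw [Finset.card_empty, Nat.cast_zero]
          positivity
        · simp only [Fin.cons_zero]
          rw [if_neg h, Finset.disjoint_left]
          intro v hv hvI
          refine (Finset.mem_filter.1 hv).2 ?_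
          have hm := hSmax (insert v S) (by
            rw [Finset.mem_powerset]; exact Finset.insert_subset hvI hSI)
          have hci : ((insert v S).card : ℝ) ≤ S.card + 1 := by
            exact_mod_cast Finset.card_insert_le v S
          have : μ * ((insert v S).card : ℝ) ≤ μ * (S.card + 1) := by gcongr
          linarith

/-- Iterated containers: every independent set of `H` inside `W` lies in a set spanning few tuples
and determined by boundedly many small subsets of the independent set. -/
theorem exists_containers (s : ℕ) (K c R : ℝ) (hK : 0 < K) (hc : 0 < c) (hR : 0 < R) :
    ∃ (m : ℕ) (B : ℝ), 0 < B ∧ ∀ D n : ℝ, 0 < D → 0 < n → ∀ W : Finset V, (W.card : ℝ) ≤ R * n →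
      ∀ H : Finset (Fin (s + 1) → V), DegBound K D H →
        ∃ C : (Fin m → Finset V) → Finset V,
          (∀ T, ((H.filter fun e => ∀ i, e i ∈ C T).card : ℝ) < c * n * D ^ s) ∧
          ∀ I : Finset V, I ⊆ W → (∀ e ∈ H, ¬ ∀ i, e i ∈ I) →
            ∃ T, (∀ i, T i ⊆ I ∧ ((T i).card : ℝ) ≤ B * (n / D)) ∧ I ⊆ C T := by
  classical
  obtain ⟨δ, B, hδ, hB, hstep⟩ := exists_container_step (V := V) s K c R hK hc hR
  have key : ∀ j : ℕ, ∀ D n : ℝ, 0 < D → 0 < n → ∀ W : Finset V, (W.card : ℝ) ≤ R * n →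
      (W.card : ℝ) ≤ j * (δ * n) → ∀ H : Finset (Fin (s + 1) → V), DegBound K D H →
        ∃ C : (Fin (s * j) → Finset V) → Finset V,
          (∀ T, ((H.filter fun e => ∀ i, e i ∈ C T).card : ℝ) < c * n * D ^ s) ∧
          ∀ I : Finset V, I ⊆ W → (∀ e ∈ H, ¬ ∀ i, e i ∈ I) →
            ∃ T, (∀ i, T i ⊆ I ∧ ((T i).card : ℝ) ≤ B * (n / D)) ∧ I ⊆ C T := by
    intro j D n hD hn
    have hfew : ∀ (j : ℕ) (W : Finset V) (H : Finset (Fin (s + 1) → V)),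
        ((H.filter fun e => ∀ i, e i ∈ W).card : ℝ) < c * n * D ^ s →
        ∃ C : (Fin (s * j) → Finset V) → Finset V,
          (∀ T, ((H.filter fun e => ∀ i, e i ∈ C T).card : ℝ) < c * n * D ^ s) ∧
          ∀ I : Finset V, I ⊆ W → (∀ e ∈ H, ¬ ∀ i, e i ∈ I) →
            ∃ T, (∀ i, T i ⊆ I ∧ ((T i).card : ℝ) ≤ B * (n / D)) ∧ I ⊆ C T := by
      intro j W H h
      refine ⟨fun _ => W, fun _ => h, fun I hIW _ => ⟨fun _ => ∅, fun i => ⟨by simp, ?_⟩, hIW⟩⟩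
      rw [Finset.card_empty, Nat.cast_zero]
      positivity
    induction j with
    | zero =>
      intro W hW hWj H hH
      refine hfew 0 W H ?_
      have hW0 : W = ∅ := by
        rw [Nat.cast_zero, zero_mul] at hWj
        rw [← Finset.card_eq_zero]
        exact_mod_cast le_antisymm hWj (Nat.cast_nonneg _)
      subst hW0
      have : H.filter (fun e => ∀ i, e i ∈ (∅ : Finset V)) = ∅ :=
        Finset.filter_false_of_mem fun e _ h => by simpa using h 0
      rw [this, Finset.card_empty, Nat.cast_zero]
      positivity
    | succ j ih =>
      intro W hW hWj H hH
      by_cases h : ((H.filter fun e => ∀ i, e i ∈ W).card : ℝ) < c * n * D ^ s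
      · exact hfew (j + 1) W H h
      obtain ⟨X, hX, hXI⟩ := hstep D n hD hn W hW (H.filter fun e => ∀ i, e i ∈ W)
        (fun e he => (Finset.mem_filter.1 he).2) (hH.mono (Finset.filter_subset _ _)) (not_lt.1 h)
      have hle : ∀ T, (((W \ X T).card : ℕ) : ℝ) ≤ W.card - δ * n := by
        intro T
        have h1 := Finset.card_sdiff_add_card_eq_card (hX T).1
        have h2 := (hX T).2
        have h3 : (((W \ X T).card : ℕ) : ℝ) + (X T).card = W.card := by exact_mod_cast h1
        linarith
      have hrec := fun T => ih (W \ X T) (le_trans (hle T) (by nlinarith)) (le_trans (hle T) (by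
        push_cast at hWj; linarith)) H hH
      choose C hC hCI using hrec
      refine ⟨fun T => C (fun i => T (Fin.natAdd (s * j) i)) fun i => T (Fin.castAdd s i),
        fun T => hC _ _, fun I hIW hI => ?_⟩
      obtain ⟨T₁, hT₁, hd⟩ := hXI I fun e he => hI e (Finset.mem_filter.1 he).1
      obtain ⟨T₂, hT₂, hIC⟩ := hCI T₁ I
        (fun v hv => Finset.mem_sdiff.2 ⟨hIW hv, fun hvX => Finset.disjoint_left.1 hd hvX hv⟩) hI
      refine ⟨Fin.append T₂ T₁, fun i => ?_, ?_⟩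
      · refine Fin.addCases (fun i => ?_) (fun i => ?_) i
        · rw [Fin.append_left]; exact hT₂ i
        · rw [Fin.append_right]; exact hT₁ i
      · have h₁ : (fun i => Fin.append T₂ T₁ (Fin.natAdd (s * j) i)) = T₁ :=
          funext (Fin.append_right T₂ T₁)
        have h₂ : (fun i => Fin.append T₂ T₁ (Fin.castAdd s i)) = T₂ :=
          funext (Fin.append_left T₂ T₁)
        beta_reduce
        rw [h₁, h₂]
        exact hIC
  refine ⟨s * ⌈R / δ⌉₊, B, hB, fun D n hD hn W hW H hH =>
    key ⌈R / δ⌉₊ D n hD hn W hW (hW.trans ?_) H hH⟩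
  have : R / δ ≤ ⌈R / δ⌉₊ := Nat.le_ceil _
  rw [div_le_iff₀ hδ] at this
  nlinarith

end Containers

section ColouredProgressions

open scoped Classical in
/-- Tuples of coloured integers `(x, c)`, with `1 ≤ x ≤ n` and `c < r`, whose integers form a
`k`-term arithmetic progression and whose colours are distinct. -/
noncomputable def rainbowTuples (k n r : ℕ) : Finset (Fin k → ℕ × ℕ) :=
  (Fintype.piFinset fun _ => Finset.Icc 1 n ×ˢ Finset.range r).filter fun e =>
    (∃ a d : ℕ, 1 ≤ d ∧ ∀ i : Fin k, (e i).1 = a + i * d) ∧ Function.Injective fun i => (e i).2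

lemma mem_rainbowTuples {k n r : ℕ} {e : Fin k → ℕ × ℕ} : e ∈ rainbowTuples k n r ↔
    (∀ i, (1 ≤ (e i).1 ∧ (e i).1 ≤ n) ∧ (e i).2 < r) ∧
    (∃ a d : ℕ, 1 ≤ d ∧ ∀ i : Fin k, (e i).1 = a + i * d) ∧
      Function.Injective fun i => (e i).2 := by
  classical
  unfold rainbowTuples
  rw [Finset.mem_filter]
  simp [Fintype.mem_piFinset]

/-- A progression is determined by two of its terms. -/
lemma progression_determined {a d a' d' i j : ℕ} (hij : i ≠ j) (hi : a + i * d = a' + i * d')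
    (hj : a + j * d = a' + j * d') : a = a' ∧ d = d' := by
  have hd : d = d' := by
    zify at *
    have : ((i : ℤ) - j) * (d - d') = 0 := by linear_combination hi - hj
    rcases mul_eq_zero.1 this with h | h
    · exact absurd (by linarith) hij
    · linarith
  subst hd
  exact ⟨by omega, rfl⟩

lemma rainbowTuples_ext {k n r : ℕ} {e e' : Fin k → ℕ × ℕ} (he : e ∈ rainbowTuples k n r)
    (he' : e' ∈ rainbowTuples k n r) {i j : Fin k} (hij : i ≠ j) (hi : (e i).1 = (e' i).1)
    (hj : (e j).1 = (e' j).1) (hc : (fun i => (e i).2) = fun i => (e' i).2) : e = e' := by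
  obtain ⟨-, ⟨a, d, -, h⟩, -⟩ := mem_rainbowTuples.1 he
  obtain ⟨-, ⟨a', d', -, h'⟩, -⟩ := mem_rainbowTuples.1 he'
  rw [h, h'] at hi hj
  obtain ⟨rfl, rfl⟩ := progression_determined (fun hh => hij (Fin.ext hh)) hi hj
  funext l
  exact Prod.ext ((h l).trans (h' l).symm) (congrFun hc l)

lemma degBound_rainbowTuples {s n r : ℕ} (hs : 1 ≤ s) {D : ℝ} (hD : 1 ≤ D)
    (hDn : (n : ℝ) ≤ D ^ s) : DegBound ((r : ℝ) ^ (s + 1)) D (rainbowTuples (s + 1) n r) := by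
  classical
  intro J hJ y
  have hcol : ∀ e ∈ rainbowTuples (s + 1) n r,
      (fun i => (e i).2) ∈ Fintype.piFinset fun _ : Fin (s + 1) => Finset.range r := by
    intro e he
    rw [Fintype.mem_piFinset]
    exact fun i => Finset.mem_range.2 ((mem_rainbowTuples.1 he).1 i).2
  have hcolcard : (Fintype.piFinset fun _ : Fin (s + 1) => Finset.range r).card = r ^ (s + 1) := by
    simp
  unfold tupleDeg
  obtain ⟨i, hi⟩ := hJ
  rcases Nat.lt_or_ge 1 J.card with h | h
  · obtain ⟨j, hj, hji⟩ := Finset.exists_mem_ne h i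
    have h1 : ((rainbowTuples (s + 1) n r).filter fun e => ∀ i ∈ J, e i = y i).card
        ≤ r ^ (s + 1) := by
      rw [← hcolcard]
      refine Finset.card_le_card_of_injOn (fun e i => (e i).2)
        (fun e he => hcol e (Finset.mem_filter.1 he).1) fun e he e' he' hee => ?_
      have he := Finset.mem_filter.1 he
      have he' := Finset.mem_filter.1 he'
      exact rainbowTuples_ext he.1 he'.1 hji (by rw [he.2 j hj, he'.2 j hj])
        (by rw [he.2 i hi, he'.2 i hi]) hee
    calc _ ≤ ((r ^ (s + 1) : ℕ) : ℝ) * 1 := by rw [mul_one]; exact_mod_cast h1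
      _ ≤ _ := by
        push_cast
        gcongr
        exact one_le_pow₀ hD
  · have hJ1 : J.card = 1 := le_antisymm h (Finset.card_pos.2 ⟨i, hi⟩)
    have : Nontrivial (Fin (s + 1)) := Fin.nontrivial_iff_two_le.2 (by omega)
    obtain ⟨j, hji⟩ := exists_ne i
    have h1 : ((rainbowTuples (s + 1) n r).filter fun e => ∀ i ∈ J, e i = y i).card
        ≤ r ^ (s + 1) * n := by
      have hc : ((Fintype.piFinset fun _ : Fin (s + 1) => Finset.range r) ×ˢ
          Finset.Icc 1 n).card = r ^ (s + 1) * n := by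
        rw [Finset.card_product, hcolcard, Nat.card_Icc, Nat.add_sub_cancel]
      rw [← hc]
      refine Finset.card_le_card_of_injOn (fun e => (fun i => (e i).2, (e j).1))
        (fun e he => ?_) fun e he e' he' hee => ?_
      · have he := (Finset.mem_filter.1 he).1
        refine Finset.mem_coe.2 (Finset.mem_product.2 ⟨hcol e he, ?_⟩)
        exact Finset.mem_Icc.2 ((mem_rainbowTuples.1 he).1 j).1
      · have he := Finset.mem_filter.1 he
        have he' := Finset.mem_filter.1 he'
        rw [Prod.mk.injEq] at hee
        exact rainbowTuples_ext he.1 he'.1 hji hee.2 (by rw [he.2 i hi, he'.2 i hi]) hee.1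
    calc _ ≤ ((r ^ (s + 1) * n : ℕ) : ℝ) := by exact_mod_cast h1
      _ ≤ _ := by
        rw [hJ1]
        push_cast
        gcongr

/-- A colouring of most of `[n]` with small colour classes has many rainbow progressions. -/
lemma card_rainbowTuples_of_colouring {k n r u M : ℕ} (hk : 2 ≤ k) (C : Finset (ℕ × ℕ))
    (X : Finset ℕ) (hX : X ⊆ Finset.Icc 1 n) (hu : (Finset.Icc 1 n \ X).card ≤ u) (f : ℕ → ℕ)
    (hf : ∀ x ∈ X, f x < r ∧ (x, f x) ∈ C)
    (hM : ∀ c, (X.filter fun x => f x = c).card ≤ M) :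
    (n / 2) * (n / (2 * k)) ≤ ((rainbowTuples k n r).filter fun e => ∀ i, e i ∈ C).card
      + k * (u * n) + k * k * (n * M) := by
  classical
  set P := Finset.Icc 1 (n / 2) ×ˢ Finset.Icc 1 (n / (2 * k)) with hP
  have hPcard : P.card = (n / 2) * (n / (2 * k)) := by simp [hP]
  have hrange : ∀ q ∈ P, ∀ i < k, 1 ≤ q.1 + i * q.2 ∧ q.1 + i * q.2 ≤ n := by
    intro q hq i hi
    simp only [hP, Finset.mem_product, Finset.mem_Icc] at hq
    refine ⟨by omega, ?_⟩
    have h1 : i * q.2 ≤ k * (n / (2 * k)) := Nat.mul_le_mul hi.le hq.2.2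
    have h2 : k * (n / (2 * k)) ≤ n / 2 := by
      rw [← Nat.div_div_eq_div_mul]
      exact Nat.mul_div_le _ _
    omega
  have hdn : ∀ q ∈ P, 1 ≤ q.2 ∧ q.2 ≤ n := by
    intro q hq
    simp only [hP, Finset.mem_product, Finset.mem_Icc] at hq
    exact ⟨hq.2.1, hq.2.2.trans (Nat.div_le_self _ _)⟩
  set good := P.filter fun q => (∀ i : Fin k, q.1 + (i : ℕ) * q.2 ∈ X) ∧
    ∀ i j : Fin k, f (q.1 + i * q.2) = f (q.1 + j * q.2) → i = j with hgood
  set miss : Fin k → Finset (ℕ × ℕ) := fun i => P.filter fun q => q.1 + (i : ℕ) * q.2 ∉ X with hmiss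
  set clash : Fin k × Fin k → Finset (ℕ × ℕ) := fun t => P.filter fun q => t.1 ≠ t.2 ∧
    q.1 + t.1 * q.2 ∈ X ∧ q.1 + t.2 * q.2 ∈ X ∧ f (q.1 + t.1 * q.2) = f (q.1 + t.2 * q.2)
    with hclash
  have hcover : P ⊆ (good ∪ Finset.univ.biUnion miss) ∪ Finset.univ.biUnion clash := by
    intro q hq
    simp only [Finset.mem_union, Finset.mem_biUnion, Finset.mem_univ, true_and, hgood, hmiss,
      hclash, Finset.mem_filter, hq]
    by_contra hcon
    push Not at hcon
    obtain ⟨⟨h1, h2⟩, h3⟩ := hcon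
    obtain ⟨i, j, hij, hne⟩ := h1 h2
    exact h3 (i, j) hne (h2 i) (h2 j) hij
  have hgoodcard : good.card ≤ ((rainbowTuples k n r).filter fun e => ∀ i, e i ∈ C).card := by
    refine Finset.card_le_card_of_injOn
      (fun q i => (q.1 + i * q.2, f (q.1 + i * q.2))) (fun q hq => ?_) fun q hq q' hq' h => ?_
    · simp only [hgood, Finset.coe_filter, Set.mem_ofPred_eq] at hq
      obtain ⟨hqP, hqX, hqf⟩ := hq
      simp only [Finset.coe_filter, Set.mem_ofPred_eq, mem_rainbowTuples]
      exact ⟨⟨fun i => ⟨hrange q hqP i i.2, (hf _ (hqX i)).1⟩,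
        ⟨q.1, q.2, (hdn q hqP).1, fun i => rfl⟩, fun i j hij => hqf i j hij⟩,
        fun i => (hf _ (hqX i)).2⟩
    · have hq := (Finset.mem_filter.1 hq).1
      have h0 := (Prod.mk.inj (congrFun h ⟨0, by omega⟩)).1
      have h1 := (Prod.mk.inj (congrFun h ⟨1, by omega⟩)).1
      have := progression_determined (by simp) h0 h1
      exact Prod.ext this.1 this.2
  have hmisscard : ∀ i, (miss i).card ≤ u * n := by
    intro i
    have hc : ((Finset.Icc 1 n \ X) ×ˢ Finset.Icc 1 n).card ≤ u * n := by
      rw [Finset.card_product, Nat.card_Icc, Nat.add_sub_cancel]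
      exact Nat.mul_le_mul_right _ hu
    refine le_trans (Finset.card_le_card_of_injOn (fun q => (q.1 + i * q.2, q.2))
      (fun q hq => ?_) fun q hq q' hq' h => ?_) hc
    · have hq := Finset.mem_filter.1 hq
      refine Finset.mem_coe.2 (Finset.mem_product.2 ⟨?_, Finset.mem_Icc.2 (hdn q hq.1)⟩)
      exact Finset.mem_sdiff.2 ⟨Finset.mem_Icc.2 (hrange q hq.1 i i.2), hq.2⟩
    · have h := Prod.mk.inj h
      refine Prod.ext ?_ h.2
      have := h.1
      rw [h.2] at this
      exact Nat.add_right_cancel this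
  have hclashcard : ∀ t, (clash t).card ≤ n * M := by
    intro t
    have hc : (X.sigma fun x => X.filter fun y => f y = f x).card ≤ n * M := by
      rw [Finset.card_sigma]
      refine (Finset.sum_le_card_nsmul _ _ M fun x _ => hM (f x)).trans ?_
      have := Finset.card_le_card hX
      rw [Nat.card_Icc, Nat.add_sub_cancel] at this
      exact Nat.mul_le_mul_right _ this
    refine le_trans (Finset.card_le_card_of_injOn
      (fun q => (⟨q.1 + t.1 * q.2, q.1 + t.2 * q.2⟩ : Σ _ : ℕ, ℕ))
      (fun q hq => ?_) fun q hq q' hq' h => ?_) hc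
    · have hq := (Finset.mem_filter.1 hq).2
      refine Finset.mem_coe.2 (Finset.mem_sigma.2 ⟨hq.2.1, ?_⟩)
      exact Finset.mem_filter.2 ⟨hq.2.2.1, hq.2.2.2.symm⟩
    · have hq := (Finset.mem_filter.1 hq).2
      have h1 : q.1 + t.1 * q.2 = q'.1 + t.1 * q'.2 := congrArg Sigma.fst h
      have h2 : q.1 + t.2 * q.2 = q'.1 + t.2 * q'.2 :=
        congrArg (fun z : Σ _ : ℕ, ℕ => z.2) h
      have := progression_determined (fun hh => hq.1 (Fin.ext hh)) h1 h2
      exact Prod.ext this.1 this.2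
  rw [← hPcard]
  calc P.card ≤ _ := Finset.card_le_card hcover
    _ ≤ good.card + (Finset.univ.biUnion miss).card + (Finset.univ.biUnion clash).card :=
      (Finset.card_union_le _ _).trans (Nat.add_le_add_right (Finset.card_union_le _ _) _)
    _ ≤ _ := by
      refine Nat.add_le_add (Nat.add_le_add hgoodcard ?_) ?_
      · refine (Finset.card_biUnion_le_card_mul _ _ _ fun i _ => hmisscard i).trans ?_
        simp
      · refine (Finset.card_biUnion_le_card_mul _ _ _ fun i _ => hclashcard i).trans ?_
        simp

/-- The integers of `[n]` all of whose available colours in `C` lie in `Q`. -/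
def confined (n r : ℕ) (C : Finset (ℕ × ℕ)) (Q : Finset ℕ) : Finset ℕ :=
  (Finset.Icc 1 n).filter fun x => ∀ c < r, (x, c) ∈ C → c ∈ Q

/-- If few integers are confined to any given set of colours, then there are many rainbow
progressions in `C`. -/
lemma card_rainbowTuples_of_confined {k n r u M : ℕ} (hk : 2 ≤ k) (C : Finset (ℕ × ℕ))
    (hu : (confined n r C ∅).card ≤ u)
    (hM : ∀ Q ⊆ Finset.range r, Q.Nonempty → (confined n r C Q).card ≤ Q.card * M) :
    (n / 2) * (n / (2 * k)) ≤ ((rainbowTuples k n r).filter fun e => ∀ i, e i ∈ C).card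
      + k * (u * n) + k * k * (n * M) := by
  classical
  set X := Finset.Icc 1 n \ confined n r C ∅ with hX
  set L : ℕ → Finset ℕ := fun x => (Finset.range r).filter fun c => (x, c) ∈ C with hL
  have hall : ∀ Y : Finset {x // x ∈ X},
      Y.card ≤ (Y.biUnion fun x => L x.1 ×ˢ Finset.range M).card := by
    intro Y
    have hprod : (Y.biUnion fun x => L x.1 ×ˢ Finset.range M)
        = (Y.biUnion fun x => L x.1) ×ˢ Finset.range M := by
      ext ⟨c, m⟩
      simp only [Finset.mem_biUnion, Finset.mem_product]
      tauto
    rw [hprod, Finset.card_product, Finset.card_range]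
    rcases Y.eq_empty_or_nonempty with rfl | ⟨y, hy⟩
    · simp
    · refine le_trans ?_ (hM (Y.biUnion fun x => L x.1) ?_ ?_)
      · rw [← Finset.card_map (Function.Embedding.subtype _)]
        refine Finset.card_le_card fun x hx => ?_
        obtain ⟨z, hz, rfl⟩ := Finset.mem_map.1 hx
        refine Finset.mem_filter.2 ⟨(Finset.mem_sdiff.1 z.2).1, fun c hc hcC => ?_⟩
        exact Finset.mem_biUnion.2 ⟨z, hz, Finset.mem_filter.2 ⟨Finset.mem_range.2 hc, hcC⟩⟩
      · exact Finset.biUnion_subset.2 fun x _ => Finset.filter_subset _ _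
      · have hy2 := Finset.mem_sdiff.1 y.2
        by_contra hcon
        rw [Finset.not_nonempty_iff_eq_empty] at hcon
        refine hy2.2 (Finset.mem_filter.2 ⟨hy2.1, fun c hc hcC => ?_⟩)
        rw [← hcon]
        exact Finset.mem_biUnion.2 ⟨y, hy, Finset.mem_filter.2 ⟨Finset.mem_range.2 hc, hcC⟩⟩
  obtain ⟨g, hginj, hg⟩ := (Finset.all_card_le_biUnion_card_iff_exists_injective _).1 hall
  refine card_rainbowTuples_of_colouring hk C X Finset.sdiff_subset ?_
    (fun x => if h : x ∈ X then (g ⟨x, h⟩).1 else 0) (fun x hx => ?_) fun c => ?_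
  · rw [hX, Finset.sdiff_sdiff_eq_self (show confined n r C ∅ ⊆ _ from Finset.filter_subset _ _)]
    exact hu
  · have := (Finset.mem_product.1 (hg ⟨x, hx⟩)).1
    rw [Finset.mem_filter, Finset.mem_range] at this
    simpa only [dif_pos hx] using this
  · rw [← Finset.card_range M]
    refine Finset.card_le_card_of_injOn (fun x => if h : x ∈ X then (g ⟨x, h⟩).2 else 0)
      (fun x hx => ?_) fun x hx x' hx' h => ?_
    · have hx := (Finset.mem_filter.1 hx).1
      simp only [dif_pos hx]
      exact (Finset.mem_product.1 (hg ⟨x, hx⟩)).2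
    · have hx := Finset.mem_filter.1 hx
      have hx' := Finset.mem_filter.1 hx'
      simp only [dif_pos hx.1, dif_pos hx'.1] at h hx hx'
      have := hginj (Prod.ext (hx.2.trans hx'.2.symm) h)
      exact congrArg Subtype.val this

/-- A set of coloured integers spanning few rainbow progressions confines many integers to a small
set of colours. -/
lemma exists_large_confined {k n r : ℕ} (hk : 2 ≤ k) (hr : r = 2000 * k ^ 3) (hn : r ≤ n)
    (C : Finset (ℕ × ℕ))
    (hC : (((rainbowTuples k n r).filter fun e => ∀ i, e i ∈ C).card : ℝ)
      < 1 / (32 * k) * n * n) :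
    ∃ Q ⊆ Finset.range r, (1 + 16 * (Q.card : ℝ)) * n ≤ r * (confined n r C Q).card := by
  by_contra! hcon
  have hk0 : (1 : ℝ) ≤ k := by exact_mod_cast one_le_two.trans hk
  have hrk : (r : ℝ) = 2000 * (k : ℝ) ^ 3 := by exact_mod_cast hr
  have hr0 : (0 : ℝ) < r := by rw [hrk]; positivity
  have hn0 : (r : ℝ) ≤ n := by exact_mod_cast hn
  have hnpos : (0 : ℝ) < n := hr0.trans_le hn0
  have hmain := card_rainbowTuples_of_confined (k := k) (n := n) (r := r)
    (u := ⌊(n : ℝ) / r⌋₊) (M := ⌈17 * (n : ℝ) / r⌉₊) hk C ?_ ?_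
  · have hu : ((⌊(n : ℝ) / r⌋₊ : ℕ) : ℝ) ≤ n / r := Nat.floor_le (by positivity)
    have hM : ((⌈17 * (n : ℝ) / r⌉₊ : ℕ) : ℝ) ≤ 18 * n / r := by
      have h1 := (Nat.ceil_lt_add_one (a := 17 * (n : ℝ) / r) (by positivity)).le
      have h2 : 1 ≤ (n : ℝ) / r := by rwa [le_div_iff₀ hr0, one_mul]
      calc _ ≤ _ := h1
        _ ≤ 17 * (n : ℝ) / r + n / r := by linarith
        _ = _ := by ring
    have h2k : 2 * k ≤ n := by
      refine le_trans ?_ hn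
      rw [hr]
      nlinarith [Nat.one_le_pow 2 k (by omega), pow_succ k 2]
    have hdiv2 : (n : ℝ) / 4 ≤ ((n / 2 : ℕ) : ℝ) := by
      have : n ≤ 4 * (n / 2) := by omega
      have : (n : ℝ) ≤ 4 * ((n / 2 : ℕ) : ℝ) := by exact_mod_cast this
      linarith
    have hdiv2k : (n : ℝ) / (4 * k) ≤ ((n / (2 * k) : ℕ) : ℝ) := by
      have h1 : 1 ≤ n / (2 * k) := (Nat.one_le_div_iff (by omega)).2 h2k
      have h2 : n < 2 * k * (n / (2 * k) + 1) := Nat.lt_mul_div_succ n (by omega)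
      have h3 : n ≤ 4 * k * (n / (2 * k)) := by nlinarith
      rw [div_le_iff₀ (by positivity)]
      have : (n : ℝ) ≤ 4 * k * ((n / (2 * k) : ℕ) : ℝ) := by exact_mod_cast h3
      linarith
    have hmain' : ((n / 2 : ℕ) : ℝ) * ((n / (2 * k) : ℕ) : ℝ) ≤
        ((rainbowTuples k n r).filter fun e => ∀ i, e i ∈ C).card
        + k * ((⌊(n : ℝ) / r⌋₊ : ℕ) * n) + k * k * (n * (⌈17 * (n : ℝ) / r⌉₊ : ℕ)) := by
      exact_mod_cast hmain
    have hlow : (n : ℝ) / 4 * (n / (4 * k)) ≤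
        ((n / 2 : ℕ) : ℝ) * ((n / (2 * k) : ℕ) : ℝ) := by gcongr
    have h1 : (k : ℝ) * ((⌊(n : ℝ) / r⌋₊ : ℕ) * n) ≤ k * (n / r * n) := by gcongr
    have h2 : (k : ℝ) * k * (n * (⌈17 * (n : ℝ) / r⌉₊ : ℕ)) ≤ k * k * (n * (18 * n / r)) := by
      gcongr
    have h3 : (k : ℝ) * (n / r * n) ≤ k * k * (n / r * n) := by
      have : (k : ℝ) ≤ k * k := le_mul_of_one_le_left (by positivity) hk0
      gcongr
    have h4 : (k : ℝ) * k * (n / r * n) = n * n / k * (1 / 2000) := by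
      rw [hrk]; field_simp
    have h5 : (k : ℝ) * k * (n * (18 * n / r)) = n * n / k * (18 / 2000) := by
      rw [hrk]; field_simp
    have h6 : (n : ℝ) / 4 * (n / (4 * k)) = n * n / k * (1 / 16) := by field_simp; norm_num
    have h7 : 1 / (32 * (k : ℝ)) * n * n = n * n / k * (1 / 32) := by field_simp
    have h8 : 0 < (n : ℝ) * n / k := by positivity
    linarith
  · rw [Nat.le_floor_iff (by positivity), le_div_iff₀ hr0]
    have := hcon ∅ (Finset.empty_subset _)
    rw [Finset.card_empty, Nat.cast_zero] at this
    linarith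
  · intro Q hQ hQne
    have h1 := hcon Q hQ
    have hQ1 : (1 : ℝ) ≤ Q.card := by exact_mod_cast hQne.card_pos
    have h2 : ((confined n r C Q).card : ℝ) ≤ Q.card * (17 * n / r) := by
      rw [← mul_div_assoc, le_div_iff₀ hr0]
      nlinarith
    have h3 : (Q.card : ℝ) * (17 * n / r) ≤ Q.card * (⌈17 * (n : ℝ) / r⌉₊ : ℕ) := by
      gcongr
      exact Nat.le_ceil _
    exact_mod_cast h2.trans h3

end ColouredProgressions

section Merging

/-- Colours can be merged into `r` classes without any class becoming too large. -/
lemma exists_merge (A : Finset ℕ) (χ : ℕ → ℕ) {r : ℕ} (hr : 0 < r)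
    (h : ∀ i, r * (A.filter fun x => χ x = i).card ≤ A.card) :
    ∃ ψ : ℕ → ℕ, (∀ c, ψ c < r) ∧ ∀ c, r * (A.filter fun x => ψ (χ x) = c).card ≤ 2 * A.card := by
  have key : ∀ Q : Finset ℕ, ∃ ψ : ℕ → ℕ, (∀ c, ψ c < r) ∧
      ∀ c, r * (A.filter fun x => χ x ∈ Q ∧ ψ (χ x) = c).card ≤ 2 * A.card := by
    intro Q
    induction Q using Finset.induction_on with
    | empty => exact ⟨fun _ => 0, fun _ => hr, by simp⟩
    | insert q Q hq ih =>
      obtain ⟨ψ, hψ, hload⟩ := ih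
      obtain ⟨c₀, hc₀, hmin⟩ : ∃ c < r,
          r * (A.filter fun x => χ x ∈ Q ∧ ψ (χ x) = c).card ≤ A.card := by
        by_contra! hcon
        have h1 : ∑ c ∈ Finset.range r, (A.filter fun x => χ x ∈ Q ∧ ψ (χ x) = c).card
            ≤ A.card := by
          rw [← Finset.card_biUnion]
          · exact Finset.card_le_card (Finset.biUnion_subset.2 fun _ _ => Finset.filter_subset _ _)
          · intro c _ c' _ hcc
            refine Finset.disjoint_left.2 fun x hx hx' => hcc ?_
            rw [← (Finset.mem_filter.1 hx).2.2, ← (Finset.mem_filter.1 hx').2.2]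
        have h2 : ∑ _c ∈ Finset.range r, A.card < ∑ c ∈ Finset.range r,
            r * (A.filter fun x => χ x ∈ Q ∧ ψ (χ x) = c).card :=
          Finset.sum_lt_sum_of_nonempty ⟨0, Finset.mem_range.2 hr⟩
            fun c hc => hcon c (Finset.mem_range.1 hc)
        rw [← Finset.mul_sum, Finset.sum_const, Finset.card_range, smul_eq_mul] at h2
        exact absurd (Nat.mul_le_mul_left r h1) (not_le.2 h2)
      refine ⟨Function.update ψ q c₀, fun c => ?_, fun c => ?_⟩
      · rcases eq_or_ne c q with rfl | hc
        · simpa using hc₀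
        · simpa [hc] using hψ c
      · have hsub : (A.filter fun x => χ x ∈ insert q Q ∧ Function.update ψ q c₀ (χ x) = c) ⊆
            (A.filter fun x => χ x ∈ Q ∧ ψ (χ x) = c) ∪
              A.filter fun x => χ x = q ∧ c₀ = c := by
          intro x hx
          simp only [Finset.mem_filter, Finset.mem_union, Finset.mem_insert] at hx ⊢
          rcases eq_or_ne (χ x) q with hxq | hxq
          · rw [hxq, Function.update_self] at hx
            exact Or.inr ⟨hx.1, hxq, hx.2.2⟩
          · rw [Function.update_of_ne hxq] at hx
            exact Or.inl ⟨hx.1, hx.2.1.resolve_left hxq, hx.2.2⟩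
        rcases eq_or_ne c₀ c with rfl | hc
        · simp only [and_true] at hsub
          calc _ ≤ r * ((A.filter fun x => χ x ∈ Q ∧ ψ (χ x) = c₀).card +
                (A.filter fun x => χ x = q).card) :=
                Nat.mul_le_mul_left _ ((Finset.card_le_card hsub).trans (Finset.card_union_le _ _))
            _ ≤ 2 * A.card := by
                have := h q
                rw [mul_add]
                omega
        · simp only [hc, and_false, Finset.filter_false, Finset.union_empty] at hsub
          exact (Nat.mul_le_mul_left _ (Finset.card_le_card hsub)).trans (hload c)
  obtain ⟨ψ, hψ, hload⟩ := key (A.image χ)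
  refine ⟨ψ, hψ, fun c => le_trans (Nat.mul_le_mul_left _ (Finset.card_le_card ?_)) (hload c)⟩
  intro x hx
  rw [Finset.mem_filter] at hx ⊢
  exact ⟨hx.1, Finset.mem_image_of_mem _ hx.1, hx.2⟩

/-- A set that is not `(1/r, k)`-rb carries an independent set of coloured integers in which no
colour set covers too much. -/
lemma exists_independent_of_not_isRb {k n r : ℕ} (hr : 0 < r) {A : Finset ℕ}
    (hrb : ¬ IsRb (1 / r) k A) :
    ∃ f : ℕ → ℕ, (∀ x, f x < r) ∧
      (∀ e ∈ rainbowTuples k n r, ¬ ∀ i, e i ∈ A.image fun x => (x, f x)) ∧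
      ∀ Q : Finset ℕ, r * (A.filter fun x => f x ∈ Q).card ≤ Q.card * (2 * A.card) := by
  unfold IsRb at hrb
  push Not at hrb
  obtain ⟨χ, hχ, hno⟩ := hrb
  have hr0 : (0 : ℝ) < r := by exact_mod_cast hr
  obtain ⟨ψ, hψ, hload⟩ := exists_merge A χ hr fun i => by
    have := hχ i
    rw [one_div, inv_mul_eq_div, le_div_iff₀ hr0] at this
    rw [mul_comm]
    exact_mod_cast this
  refine ⟨fun x => ψ (χ x), fun x => hψ _, fun e he heI => ?_, fun Q => ?_⟩
  · obtain ⟨-, ⟨a, d, hd, h⟩, hinj⟩ := mem_rainbowTuples.1 he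
    have hmem : ∀ i : Fin k, a + i * d ∈ A ∧ ψ (χ (a + i * d)) = (e i).2 := by
      intro i
      obtain ⟨x, hx, hxe⟩ := Finset.mem_image.1 (heI i)
      have h1 : x = a + i * d := by rw [← h i, ← hxe]
      subst h1
      exact ⟨hx, by rw [← hxe]⟩
    refine hno a d ⟨hd, fun i hi => (hmem ⟨i, hi⟩).1⟩ fun i hi j hj hij hχe => hij ?_
    have : (⟨i, hi⟩ : Fin k) = ⟨j, hj⟩ := hinj (by
      change (e _).2 = (e _).2
      rw [← (hmem ⟨i, hi⟩).2, ← (hmem ⟨j, hj⟩).2]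
      exact congrArg ψ hχe)
    exact congrArg Fin.val this
  · have : (A.filter fun x => ψ (χ x) ∈ Q) = Q.biUnion fun c => A.filter fun x => ψ (χ x) = c := by
      ext x
      simp only [Finset.mem_filter, Finset.mem_biUnion]
      constructor
      · exact fun hx => ⟨_, hx.2, hx.1, rfl⟩
      · rintro ⟨c, hc, hx, rfl⟩
        exact ⟨hx, hc⟩
    rw [this]
    calc _ ≤ r * ∑ c ∈ Q, (A.filter fun x => ψ (χ x) = c).card :=
          Nat.mul_le_mul_left _ Finset.card_biUnion_le
      _ = ∑ c ∈ Q, r * (A.filter fun x => ψ (χ x) = c).card := Finset.mul_sum _ _ _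
      _ ≤ Q.card * (2 * A.card) := Finset.sum_le_card_nsmul _ _ _ fun c _ => hload c

end Merging

section BinomialSubsets

open Finset

/-- The probability that the `p`-random subset of `E` equals `A`. -/
def binomWeight (E : Finset ℕ) (p : ℝ) (A : Finset ℕ) : ℝ :=
  p ^ A.card * (1 - p) ^ (E.card - A.card)

lemma binomWeight_nonneg (E : Finset ℕ) {p : ℝ} (hp : 0 ≤ p) (hp1 : p ≤ 1) (A : Finset ℕ) :
    0 ≤ binomWeight E p A := by
  have : 0 ≤ 1 - p := by linarith
  unfold binomWeight
  positivity

lemma sum_binomWeight_mul_prod (E : Finset ℕ) (p : ℝ) (g h : ℕ → ℝ) :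
    ∑ A ∈ E.powerset, binomWeight E p A * ((∏ a ∈ A, g a) * ∏ a ∈ E \ A, h a)
      = ∏ a ∈ E, (p * g a + (1 - p) * h a) := by
  rw [Finset.prod_add]
  refine Finset.sum_congr rfl fun A hA => ?_
  rw [Finset.prod_mul_distrib, Finset.prod_mul_distrib, Finset.prod_const, Finset.prod_const,
    Finset.card_sdiff_of_subset (Finset.mem_powerset.1 hA), binomWeight]
  ring

lemma sum_binomWeight (E : Finset ℕ) (p : ℝ) : ∑ A ∈ E.powerset, binomWeight E p A = 1 := by
  simpa using sum_binomWeight_mul_prod E p (fun _ => 1) fun _ => 1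

lemma sum_binomWeight_mul_exp_card_le (E : Finset ℕ) {p : ℝ} (hp : 0 ≤ p) (μ : ℝ) (hμ : 0 ≤ μ) :
    ∑ A ∈ E.powerset, binomWeight E p A * Real.exp (μ * A.card)
      ≤ Real.exp (E.card * p * (Real.exp μ - 1)) := by
  have h := sum_binomWeight_mul_prod E p (fun _ => Real.exp μ) fun _ => 1
  simp only [Finset.prod_const_one, mul_one, Finset.prod_const, ← Real.exp_nat_mul] at h
  simp only [mul_comm μ]
  rw [h, mul_assoc, Real.exp_nat_mul]
  have h1 := Real.add_one_le_exp (p * (Real.exp μ - 1))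
  have h2 : 0 ≤ p * (Real.exp μ - 1) := mul_nonneg hp (by linarith [Real.add_one_le_exp μ])
  refine pow_le_pow_left₀ ?_ ?_ _ <;> linarith

/-- Containing `U` does not affect the lower tail of the intersection with a disjoint set `Z`. -/
lemma sum_binomWeight_superset_mul_exp_le (E : Finset ℕ) {p : ℝ} (hp : 0 ≤ p) (hp1 : p ≤ 1)
    {U Z : Finset ℕ} (hUE : U ⊆ E) (hZE : Z ⊆ E) (hUZ : Disjoint U Z) :
    ∑ A ∈ E.powerset, (if U ⊆ A then binomWeight E p A * Real.exp (-((A ∩ Z).card : ℝ)) else 0)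
      ≤ Real.exp (-(Z.card * p / 2)) *
        ∑ A ∈ E.powerset, if U ⊆ A then binomWeight E p A else 0 := by
  set h : ℕ → ℝ := fun a => if a ∈ U then 0 else 1 with hh
  have hsup : ∀ A, ∏ a ∈ E \ A, h a = if U ⊆ A then (1 : ℝ) else 0 := by
    intro A
    split_ifs with hUA
    · refine Finset.prod_eq_one fun a ha => if_neg fun haU => ?_
      exact (Finset.mem_sdiff.1 ha).2 (hUA haU)
    · obtain ⟨a, haU, haA⟩ := Finset.not_subset.1 hUA
      exact Finset.prod_eq_zero (Finset.mem_sdiff.2 ⟨hUE haU, haA⟩) (if_pos haU)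
  have hexp : ∀ A : Finset ℕ, ∏ a ∈ A, (if a ∈ Z then Real.exp (-1) else 1)
      = Real.exp (-((A ∩ Z).card : ℝ)) := by
    intro A
    rw [Finset.prod_ite_mem, Finset.prod_const, ← Real.exp_nat_mul]
    ring_nf
  have h1 := sum_binomWeight_mul_prod E p (fun a => if a ∈ Z then Real.exp (-1) else 1) h
  have h2 := sum_binomWeight_mul_prod E p (fun _ => 1) h
  simp only [hsup, hexp, Finset.prod_const_one, mul_ite, mul_one, mul_zero] at h1 h2
  rw [h1, h2]
  have h3 : Real.exp (-(Z.card * p / 2)) = ∏ a ∈ E, if a ∈ Z then Real.exp (-(p / 2)) else 1 := by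
    rw [Finset.prod_ite_mem, Finset.inter_eq_right.2 hZE, Finset.prod_const, ← Real.exp_nat_mul]
    ring_nf
  rw [h3, ← Finset.prod_mul_distrib]
  have he : Real.exp (-1) ≤ 1 / 2 := by
    rw [Real.exp_neg, one_div]
    exact inv_anti₀ two_pos (by linarith [Real.add_one_le_exp 1])
  have hp2 : -(p / 2) + 1 ≤ Real.exp (-(p / 2)) := Real.add_one_le_exp _
  refine Finset.prod_le_prod (fun a _ => ?_) fun a _ => ?_
  · have : 0 ≤ 1 - p := by linarith
    simp only [hh]
    split_ifs <;> positivity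
  · simp only [hh]
    split_ifs with haZ haU haU
    · exact absurd haZ (Finset.disjoint_left.1 hUZ haU)
    · nlinarith
    · simp
    · simp

lemma card_small_subsets_le {α : Type*} [DecidableEq α] (Y : Finset α) (b t : ℝ) (ht : 0 ≤ t) :
    ((Y.powerset.filter fun S => (S.card : ℝ) ≤ b).card : ℝ)
      ≤ Real.exp (t * b + Real.exp (-t) * Y.card) := by
  have h1 : ((Y.powerset.filter fun S => (S.card : ℝ) ≤ b).card : ℝ)
      ≤ ∑ S ∈ Y.powerset, Real.exp (t * b) * Real.exp (-t) ^ S.card := by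
    rw [Finset.card_eq_sum_ones, Finset.sum_filter]
    push_cast
    refine Finset.sum_le_sum fun S _ => ?_
    split_ifs with h
    · rw [← Real.exp_nat_mul, ← Real.exp_add]
      refine Real.one_le_exp ?_
      nlinarith
    · positivity
  have h2 := Finset.sum_pow_mul_eq_add_pow (Real.exp (-t)) 1 Y
  simp only [one_pow, mul_one] at h2
  rw [← Finset.mul_sum, h2] at h1
  refine h1.trans ?_
  rw [Real.exp_add, mul_comm (Real.exp (-t)), Real.exp_nat_mul]
  have := Real.add_one_le_exp (Real.exp (-t))
  gcongr

/-- Union bound over tuples of small subsets of `A ×ˢ range r`. -/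
lemma sum_binomWeight_le_of_fingerprints {E : Finset ℕ} {p : ℝ} (hp : 0 ≤ p) (hp1 : p ≤ 1)
    {r m : ℕ} {b ρ t : ℝ} (ht : 0 ≤ t) {P : Finset ℕ → Prop} [DecidablePred P]
    (Z : (Fin m → Finset (ℕ × ℕ)) → Finset ℕ) (x : (Fin m → Finset (ℕ × ℕ)) → ℝ)
    (hZ : ∀ T, Z T ⊆ E ∧ Disjoint (univ.biUnion fun i => (T i).image Prod.fst) (Z T))
    (hx : ∀ T, (∀ i, ((T i).card : ℝ) ≤ b) → x T + ρ ≤ (Z T).card * p / 2)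
    (hP : ∀ A ⊆ E, P A → ∃ T : Fin m → Finset (ℕ × ℕ),
      (∀ i, T i ⊆ A ×ˢ range r ∧ ((T i).card : ℝ) ≤ b) ∧ ((A ∩ Z T).card : ℝ) ≤ x T) :
    ∑ A ∈ E.powerset.filter P, binomWeight E p A ≤ Real.exp (-ρ) *
      Real.exp (m * (t * b) + E.card * p * (Real.exp (m * r * Real.exp (-t)) - 1)) := by
  classical
  set small : Finset ℕ → Finset (Finset (ℕ × ℕ)) := fun A =>
    (A ×ˢ range r).powerset.filter fun S => (S.card : ℝ) ≤ b with hsmall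
  set U : (Fin m → Finset (ℕ × ℕ)) → Finset ℕ := fun T =>
    univ.biUnion fun i => (T i).image Prod.fst with hU
  set 𝒯 := Fintype.piFinset fun _ : Fin m => small E with h𝒯
  have hUE : ∀ T ∈ 𝒯, U T ⊆ E := by
    intro T hT a ha
    simp only [hU, mem_biUnion, mem_univ, true_and, mem_image] at ha
    obtain ⟨i, z, hz, rfl⟩ := ha
    have := Fintype.mem_piFinset.1 hT i
    rw [hsmall, mem_filter, mem_powerset] at this
    exact (mem_product.1 (this.1 hz)).1
  have hsub : ∀ A ⊆ E, ∀ T ∈ 𝒯, U T ⊆ A → T ∈ Fintype.piFinset fun _ : Fin m => small A := by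
    intro A _ T hT hTA
    rw [Fintype.mem_piFinset]
    intro i
    have := Fintype.mem_piFinset.1 hT i
    rw [hsmall, mem_filter, mem_powerset] at this ⊢
    refine ⟨fun z hz => mem_product.2 ⟨hTA ?_, (mem_product.1 (this.1 hz)).2⟩, this.2⟩
    exact mem_biUnion.2 ⟨i, mem_univ _, mem_image_of_mem _ hz⟩
  have hexpand : ∑ A ∈ E.powerset.filter P, binomWeight E p A ≤ ∑ A ∈ E.powerset, ∑ T ∈ 𝒯,
      Real.exp (x T) *
        (if U T ⊆ A then binomWeight E p A * Real.exp (-((A ∩ Z T).card : ℝ)) else 0) := by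
    rw [Finset.sum_filter]
    refine Finset.sum_le_sum fun A hA => ?_
    have hw := binomWeight_nonneg E hp hp1 A
    have hnn : ∀ T ∈ 𝒯, 0 ≤ Real.exp (x T) *
        (if U T ⊆ A then binomWeight E p A * Real.exp (-((A ∩ Z T).card : ℝ)) else 0) := by
      intro T _
      split_ifs <;> positivity
    split_ifs with hPA
    · have hA := mem_powerset.1 hA
      obtain ⟨T, hT, hTx⟩ := hP A hA hPA
      have hT𝒯 : T ∈ 𝒯 := by
        rw [h𝒯, Fintype.mem_piFinset]
        intro i
        rw [hsmall, mem_filter, mem_powerset]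
        exact ⟨(hT i).1.trans (product_subset_product hA subset_rfl), (hT i).2⟩
      refine le_trans ?_ (single_le_sum hnn hT𝒯)
      rw [if_pos]
      · have : 1 ≤ Real.exp (x T) * Real.exp (-((A ∩ Z T).card : ℝ)) := by
          rw [← Real.exp_add]
          exact Real.one_le_exp (by linarith)
        nlinarith
      · refine biUnion_subset.2 fun i _ => image_subset_iff.2 fun z hz => ?_
        exact (mem_product.1 ((hT i).1 hz)).1
    · exact sum_nonneg hnn
  have hfixed : ∀ T ∈ 𝒯, ∑ A ∈ E.powerset, Real.exp (x T) *
      (if U T ⊆ A then binomWeight E p A * Real.exp (-((A ∩ Z T).card : ℝ)) else 0)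
      ≤ Real.exp (-ρ) * ∑ A ∈ E.powerset, if U T ⊆ A then binomWeight E p A else 0 := by
    intro T hT
    rw [← Finset.mul_sum]
    have hnn : 0 ≤ ∑ A ∈ E.powerset, if U T ⊆ A then binomWeight E p A else 0 :=
      sum_nonneg fun A _ => by
        have := binomWeight_nonneg E hp hp1 A
        split_ifs <;> positivity
    calc _ ≤ Real.exp (x T) * (Real.exp (-((Z T).card * p / 2)) *
          ∑ A ∈ E.powerset, if U T ⊆ A then binomWeight E p A else 0) := by
          gcongr
          exact sum_binomWeight_superset_mul_exp_le E hp hp1 (hUE T hT) (hZ T).1 (hZ T).2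
      _ ≤ _ := by
          rw [← mul_assoc, ← Real.exp_add]
          gcongr
          have := hx T fun i => by
            have := Fintype.mem_piFinset.1 hT i
            rw [hsmall, mem_filter] at this
            exact this.2
          linarith
  have hcount : ∀ A ∈ E.powerset, ∑ T ∈ 𝒯, (if U T ⊆ A then binomWeight E p A else 0)
      ≤ binomWeight E p A * (Real.exp (m * (t * b)) *
        Real.exp (m * r * Real.exp (-t) * A.card)) := by
    intro A hA
    have hw := binomWeight_nonneg E hp hp1 A
    rw [← Finset.sum_filter, Finset.sum_const, nsmul_eq_mul, mul_comm]
    refine mul_le_mul_of_nonneg_left ?_ hw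
    have h1 : (𝒯.filter fun T => U T ⊆ A).card ≤ (small A).card ^ m := by
      have : (Fintype.piFinset fun _ : Fin m => small A).card = (small A).card ^ m := by simp
      rw [← this]
      refine card_le_card fun T hT => ?_
      rw [mem_filter] at hT
      exact hsub A (mem_powerset.1 hA) T hT.1 hT.2
    have h2 : ((small A).card : ℝ) ≤ Real.exp (t * b + Real.exp (-t) * (A ×ˢ range r).card) :=
      card_small_subsets_le _ b t ht
    calc (((𝒯.filter fun T => U T ⊆ A).card : ℕ) : ℝ) ≤ ((small A).card : ℝ) ^ m := by
          exact_mod_cast h1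
      _ ≤ Real.exp (t * b + Real.exp (-t) * (A ×ˢ range r).card) ^ m := by gcongr
      _ = _ := by
          rw [← Real.exp_nat_mul, ← Real.exp_add, card_product, card_range]
          push_cast
          ring_nf
  calc _ ≤ _ := hexpand
    _ = ∑ T ∈ 𝒯, ∑ A ∈ E.powerset, Real.exp (x T) *
        (if U T ⊆ A then binomWeight E p A * Real.exp (-((A ∩ Z T).card : ℝ)) else 0) :=
      Finset.sum_comm
    _ ≤ ∑ T ∈ 𝒯, Real.exp (-ρ) * ∑ A ∈ E.powerset, if U T ⊆ A then binomWeight E p A else 0 :=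
      Finset.sum_le_sum hfixed
    _ = Real.exp (-ρ) * ∑ A ∈ E.powerset, ∑ T ∈ 𝒯, if U T ⊆ A then binomWeight E p A else 0 := by
      rw [← Finset.mul_sum, Finset.sum_comm]
    _ ≤ Real.exp (-ρ) * ∑ A ∈ E.powerset, binomWeight E p A * (Real.exp (m * (t * b)) *
        Real.exp (m * r * Real.exp (-t) * A.card)) := by
      gcongr with A hA
      exact hcount A hA
    _ = Real.exp (-ρ) * (Real.exp (m * (t * b)) * ∑ A ∈ E.powerset, binomWeight E p A *
        Real.exp (m * r * Real.exp (-t) * A.card)) := by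
      rw [Finset.mul_sum (a := Real.exp (m * (t * b)))]
      congr 1
      exact Finset.sum_congr rfl fun A _ => by ring
    _ ≤ _ := by
      rw [Real.exp_add]
      gcongr
      exact sum_binomWeight_mul_exp_card_le E hp _ (by positivity)

lemma sum_binomWeight_large_card_le (E : Finset ℕ) {p : ℝ} (hp : 0 ≤ p) (hp1 : p ≤ 1) :
    ∑ A ∈ E.powerset.filter fun A => 2 * (E.card * p) < A.card, binomWeight E p A
      ≤ Real.exp (-(E.card * p / 4)) := by
  have h1 : ∑ A ∈ E.powerset.filter fun A => 2 * (E.card * p) < A.card, binomWeight E p A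
      ≤ ∑ A ∈ E.powerset, Real.exp (-(2 * (E.card * p))) *
        (binomWeight E p A * Real.exp (1 * A.card)) := by
    rw [Finset.sum_filter]
    refine Finset.sum_le_sum fun A _ => ?_
    have hw := binomWeight_nonneg E hp hp1 A
    split_ifs with h
    · have : 1 ≤ Real.exp (-(2 * (E.card * p))) * Real.exp (1 * A.card) := by
        rw [← Real.exp_add]
        exact Real.one_le_exp (by linarith)
      nlinarith
    · positivity
  rw [← Finset.mul_sum] at h1
  refine h1.trans ((mul_le_mul_of_nonneg_left
    (sum_binomWeight_mul_exp_card_le E hp 1 zero_le_one) (Real.exp_nonneg _)).trans ?_)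
  rw [← Real.exp_add]
  gcongr
  have he := Real.exp_one_lt_d9
  have : 0 ≤ (E.card : ℝ) * p := by positivity
  nlinarith

lemma binomProb_eq_one_sub (n : ℕ) (p : ℝ) (P : Finset ℕ → Prop) [DecidablePred P] :
    binomProb n p P = 1 - ∑ A ∈ (Icc 1 n).powerset.filter fun A => ¬ P A,
      binomWeight (Icc 1 n) p A := by
  rw [← sum_binomWeight (Icc 1 n) p, ← Finset.sum_filter_add_sum_filter_not _ P,
    add_sub_cancel_right, Finset.sum_filter]
  unfold binomProb binomWeight
  rw [Nat.card_Icc, Nat.add_sub_cancel]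
  exact Finset.sum_congr rfl fun A _ => by congr

end BinomialSubsets

section Assembly

open Finset

/-- A set without a rainbow progression has a small fingerprint, which determines a large set of
integers that it meets in few elements. -/
lemma exists_sparse_assignment {s r : ℕ} (hs : 1 ≤ s) (hr : r = 2000 * (s + 1) ^ 3) :
    ∃ (m : ℕ) (B : ℝ), 0 < B ∧ ∀ n : ℕ, r ≤ n → ∀ D : ℝ, 1 ≤ D → D ^ s = n →
      ∃ (X : (Fin m → Finset (ℕ × ℕ)) → Finset ℕ) (q : (Fin m → Finset (ℕ × ℕ)) → ℕ),
        (∀ T, X T ⊆ Icc 1 n ∧ (1 + 16 * (q T : ℝ)) * n ≤ r * (X T).card) ∧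
        ∀ A ⊆ Icc 1 n, ¬ IsRb (1 / r) (s + 1) A →
          ∃ T : Fin m → Finset (ℕ × ℕ),
            (∀ i, T i ⊆ A ×ˢ range r ∧ ((T i).card : ℝ) ≤ B * (n / D)) ∧
            r * (A ∩ X T).card ≤ q T * (2 * A.card) := by
  have hr0 : 0 < r := by rw [hr]; positivity
  have hr0' : (0 : ℝ) < r := by exact_mod_cast hr0
  obtain ⟨m, B, hB, hcont⟩ := exists_containers (V := ℕ × ℕ) s ((r : ℝ) ^ (s + 1))
    (1 / (32 * ((s + 1 : ℕ) : ℝ))) r (by positivity) (by positivity) hr0'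
  refine ⟨m, B, hB, fun n hn D hD hDn => ?_⟩
  have hn0 : (0 : ℝ) < n := by exact_mod_cast hr0.trans_le hn
  obtain ⟨C, hC, hfp⟩ := hcont D n (by linarith) hn0 (Icc 1 n ×ˢ range r)
    (by simp [mul_comm]) (rainbowTuples (s + 1) n r) (degBound_rainbowTuples hs hD hDn.ge)
  rw [hDn] at hC
  choose Q hQr hQ using fun T => exists_large_confined (k := s + 1) (by omega) hr hn (C T) (hC T)
  refine ⟨fun T => confined n r (C T) (Q T), fun T => (Q T).card,
    fun T => ⟨filter_subset _ _, hQ T⟩, fun A hA hrb => ?_⟩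
  obtain ⟨f, hf, hind, hcl⟩ := exists_independent_of_not_isRb (n := n) hr0 hrb
  have hI : A.image (fun x => (x, f x)) ⊆ A ×ˢ range r := by
    intro y hy
    obtain ⟨x, hx, rfl⟩ := mem_image.1 hy
    exact mem_product.2 ⟨hx, mem_range.2 (hf x)⟩
  obtain ⟨T, hT, hTC⟩ := hfp _ (hI.trans (product_subset_product hA subset_rfl)) hind
  refine ⟨T, fun i => ⟨(hT i).1.trans hI, (hT i).2⟩,
    le_trans (Nat.mul_le_mul_left _ (card_le_card fun x hx => ?_)) (hcl (Q T))⟩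
  rw [mem_inter] at hx
  exact mem_filter.2 ⟨hx.1, (mem_filter.1 hx.2).2 _ (hf x) (hTC (mem_image_of_mem _ hx.1))⟩

/-- If every set with property `P` has a fingerprint of the kind given by
`exists_sparse_assignment`, then `P` is exponentially unlikely. -/
lemma sum_binomWeight_le_of_sparse_assignment {E : Finset ℕ} {p : ℝ} (hp : 0 ≤ p) (hp1 : p ≤ 1)
    {r m : ℕ} (hr : 0 < r) {b t : ℝ} (ht : 0 ≤ t) {P : Finset ℕ → Prop} [DecidablePred P]
    (X : (Fin m → Finset (ℕ × ℕ)) → Finset ℕ) (q : (Fin m → Finset (ℕ × ℕ)) → ℕ)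
    (hX : ∀ T, X T ⊆ E ∧ (1 + 16 * (q T : ℝ)) * E.card ≤ r * (X T).card)
    (hP : ∀ A ⊆ E, P A → ∃ T : Fin m → Finset (ℕ × ℕ),
      (∀ i, T i ⊆ A ×ˢ range r ∧ ((T i).card : ℝ) ≤ b) ∧ r * (A ∩ X T).card ≤ q T * (2 * A.card))
    (hb : 2 * r * m * b ≤ E.card) (htb : 16 * r * m * t * b ≤ E.card * p)
    (het : 32 * r * (m * r * Real.exp (-t)) ≤ 1) (hEp : 16 * r ≤ E.card * p) :
    ∑ A ∈ E.powerset.filter P, binomWeight E p A ≤ Real.exp (-(E.card * p / (16 * r))) := by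
  classical
  have hr0 : (1 : ℝ) ≤ r := by exact_mod_cast hr
  set N : ℝ := (E.card : ℝ) with hN
  obtain ⟨y, hy⟩ : ∃ y, y = N * p / (16 * r) := ⟨_, rfl⟩
  have hy1 : 1 ≤ y := by rw [hy, le_div_iff₀ (by positivity)]; linarith
  have hy0 : 0 ≤ y := by linarith
  have hNp0 : 0 ≤ N * p := by positivity
  have hNp : N * p = 16 * r * y := by rw [hy]; field_simp
  have hfew : ∑ A ∈ E.powerset.filter fun A => P A ∧ (A.card : ℝ) ≤ 2 * (N * p),
      binomWeight E p A ≤ Real.exp (-(2 * y)) := by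
    refine (sum_binomWeight_le_of_fingerprints (b := b) (ρ := 4 * y) (r := r) hp hp1 ht
      (fun T => X T \ univ.biUnion fun i => (T i).image Prod.fst)
      (fun T => 64 * q T * y)
      (fun T => ⟨sdiff_subset.trans (hX T).1, disjoint_sdiff⟩) (fun T hT => ?_)
      fun A hA hPA => ?_).trans ?_
    · have h1 : ((univ.biUnion fun i => (T i).image Prod.fst).card : ℝ) ≤ m * b := by
        calc ((univ.biUnion fun i => (T i).image Prod.fst).card : ℝ)
            ≤ ∑ i, (((T i).image Prod.fst).card : ℝ) := by exact_mod_cast card_biUnion_le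
          _ ≤ ∑ _i : Fin m, b :=
            sum_le_sum fun i _ => (Nat.cast_le.2 card_image_le).trans (hT i)
          _ = m * b := by simp
      have h2 : ((X T).card : ℝ) ≤ (X T \ univ.biUnion fun i => (T i).image Prod.fst).card
          + (univ.biUnion fun i => (T i).image Prod.fst).card := by
        exact_mod_cast card_le_card_sdiff_add_card
      set z : ℝ := ((X T \ univ.biUnion fun i => (T i).image Prod.fst).card : ℝ)
      have h3 : (1 / 2 + 16 * (q T : ℝ)) * N ≤ r * z := by
        have h4 := (hX T).2
        have h5 : (r : ℝ) * (X T).card ≤ r * (z + m * b) := by gcongr; linarith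
        nlinarith
      have h6 : (1 / 2 + 16 * (q T : ℝ)) * N * p ≤ r * z * p := by gcongr
      have h7 : (r : ℝ) * ((1 / 2 + 16 * (q T : ℝ)) * (16 * y)) ≤ r * (z * p) := by
        calc _ = (1 / 2 + 16 * (q T : ℝ)) * (16 * r * y) := by ring
          _ = (1 / 2 + 16 * (q T : ℝ)) * N * p := by rw [← hNp]; ring
          _ ≤ _ := by linarith
      have h8 := le_of_mul_le_mul_left h7 (by linarith)
      have h9 : (0 : ℝ) ≤ q T * y := mul_nonneg (Nat.cast_nonneg _) hy0
      linarith
    · obtain ⟨T, hT, hTA⟩ := hP A hA hPA.1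
      refine ⟨T, hT, ?_⟩
      have h1 : (r : ℝ) * (A ∩ X T).card ≤ q T * (2 * A.card) := by exact_mod_cast hTA
      have h2 : ((A ∩ (X T \ univ.biUnion fun i => (T i).image Prod.fst)).card : ℝ)
          ≤ (A ∩ X T).card := by
        exact_mod_cast card_le_card (inter_subset_inter subset_rfl sdiff_subset)
      have h3 : (q T : ℝ) * (2 * A.card) ≤ q T * (2 * (2 * (16 * r * y))) := by
        gcongr
        rw [← hNp]
        exact hPA.2
      have h4 : (r : ℝ) * (A ∩ X T).card ≤ r * (64 * q T * y) := by linarith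
      exact h2.trans (le_of_mul_le_mul_left h4 (by linarith))
    · rw [← Real.exp_add, Real.exp_le_exp, ← hN]
      have h1 : (m : ℝ) * (t * b) ≤ y := by
        have : (16 * r : ℝ) * (m * (t * b)) ≤ 16 * r * y := by rw [← hNp]; linarith
        exact le_of_mul_le_mul_left this (by linarith)
      set μ : ℝ := m * r * Real.exp (-t)
      have hμ0 : 0 ≤ μ := by positivity
      have hμ1 : μ ≤ 1 := by nlinarith
      have h2 : Real.exp μ - 1 ≤ 2 * μ := by
        have := Real.abs_exp_sub_one_le (x := μ) (by rwa [abs_of_nonneg hμ0])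
        rw [abs_of_nonneg hμ0] at this
        exact (le_abs_self _).trans this
      have h3 : N * p * (Real.exp μ - 1) ≤ y := by
        calc N * p * (Real.exp μ - 1) ≤ N * p * (2 * μ) :=
            mul_le_mul_of_nonneg_left h2 hNp0
          _ = y * (32 * r * μ) := by rw [hNp]; ring
          _ ≤ y * 1 := mul_le_mul_of_nonneg_left het hy0
          _ = y := mul_one y
      linarith
  have hmany := sum_binomWeight_large_card_le E hp hp1
  have hsplit : ∑ A ∈ E.powerset.filter P, binomWeight E p A
      ≤ ∑ A ∈ E.powerset.filter (fun A => P A ∧ (A.card : ℝ) ≤ 2 * (N * p)), binomWeight E p A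
        + ∑ A ∈ E.powerset.filter fun A => 2 * (N * p) < A.card, binomWeight E p A := by
    simp only [sum_filter, ← sum_add_distrib]
    refine sum_le_sum fun A _ => ?_
    have := binomWeight_nonneg E hp hp1 A
    rcases le_or_gt (A.card : ℝ) (2 * (N * p)) with h | h
    · by_cases hPA : P A <;> simp [hPA, h, h.not_gt]
    · by_cases hPA : P A <;> simp [hPA, h, h.not_ge, this]
  have h1 : Real.exp (-(N * p / 4)) ≤ Real.exp (-(2 * y)) := by
    rw [Real.exp_le_exp, hNp]
    nlinarith
  have h2 : Real.exp (-(2 * y)) * 2 ≤ Real.exp (-y) := by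
    have h3 : (2 : ℝ) ≤ Real.exp y := by linarith [Real.add_one_le_exp y]
    calc Real.exp (-(2 * y)) * 2 ≤ Real.exp (-(2 * y)) * Real.exp y := by gcongr
      _ = Real.exp (-y) := by rw [← Real.exp_add]; ring_nf
  rw [← hy]
  linarith

end Assembly

theorem random_rainbow_bounded_colourings :
    ∀ k : ℕ, 3 ≤ k → ∃ C c α : ℝ, 0 < C ∧ 0 < c ∧ 0 < α ∧ ∃ N : ℕ, ∀ n : ℕ, N ≤ n →
      ∀ p : ℝ, 0 ≤ p → p ≤ 1 →
        C * (n : ℝ) ^ (-(1 : ℝ) / ((k : ℝ) - 1)) < p →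
        1 - Real.exp (-(c * n * p)) ≤ binomProb n p (IsRb α k) := by
  classical
  intro k hk
  obtain ⟨s, rfl⟩ : ∃ s, k = s + 1 := ⟨k - 1, by omega⟩
  obtain ⟨r, hr⟩ : ∃ r, r = 2000 * (s + 1) ^ 3 := ⟨_, rfl⟩
  obtain ⟨m, B, hB, hsparse⟩ := exists_sparse_assignment (by omega) hr
  have hr1 : 1 ≤ r := by rw [hr]; exact Nat.one_le_iff_ne_zero.2 (by positivity)
  have hr1' : (1 : ℝ) ≤ r := by exact_mod_cast hr1
  set t : ℝ := Real.log (32 * r ^ 2 * (m + 1)) with ht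
  have hm1 : (1 : ℝ) ≤ m + 1 := by linarith [Nat.cast_nonneg (α := ℝ) m]
  have ht0 : 0 ≤ t := Real.log_nonneg (by nlinarith)
  have het : 32 * r * (m * r * Real.exp (-t)) ≤ 1 := by
    rw [Real.exp_neg, ht, Real.exp_log (by positivity)]
    have : 32 * (r : ℝ) * (m * r * (32 * (r : ℝ) ^ 2 * ((m : ℝ) + 1))⁻¹) = (m : ℝ) / (m + 1) := by
      field_simp
    rw [this, div_le_one (by positivity)]
    linarith
  refine ⟨16 * r + 16 * r * m * t * B + 2 * r * m * B, 1 / (16 * r), 1 / r, by positivity,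
    by positivity, by positivity, r, fun n hn p hp hp1 hC => ?_⟩
  have hn1 : (1 : ℝ) ≤ n := by exact_mod_cast hr1.trans hn
  have hs0 : (s : ℝ) ≠ 0 := by
    have : s ≠ 0 := by omega
    exact_mod_cast this
  set D : ℝ := (n : ℝ) ^ (1 / (s : ℝ)) with hD
  have hD1 : 1 ≤ D := Real.one_le_rpow hn1 (by positivity)
  have hDs : D ^ s = n := by
    rw [hD, ← Real.rpow_natCast, ← Real.rpow_mul (by positivity), one_div_mul_cancel hs0,
      Real.rpow_one]
  have hDn : D ≤ n := by
    rw [← hDs]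
    exact le_self_pow₀ hD1 (by omega)
  have hDinv : (n : ℝ) ^ (-(1 : ℝ) / (((s + 1 : ℕ) : ℝ) - 1)) = D⁻¹ := by
    rw [hD, ← Real.rpow_neg (by positivity)]
    push_cast
    ring_nf
  rw [hDinv] at hC
  set w : ℝ := n / D with hw
  have hw1 : 1 ≤ w := by rw [hw, one_le_div (by linarith)]; exact hDn
  have hCw : (16 * r + 16 * r * m * t * B + 2 * r * m * B) * w ≤ n * p := by
    have := mul_le_mul_of_nonneg_left hC.le (by linarith : (0 : ℝ) ≤ n)
    rw [hw, div_eq_mul_inv]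
    linarith
  have hnp : (n : ℝ) * p ≤ n := mul_le_of_le_one_right (by linarith) hp1
  have e1 : 0 ≤ 16 * (r : ℝ) * m * t * B * w := by positivity
  have e2 : 0 ≤ 2 * (r : ℝ) * m * B * w := by positivity
  have e3 : (16 * r : ℝ) * 1 ≤ 16 * r * w := by gcongr
  obtain ⟨X, q, hX, hA⟩ := hsparse n hn D hD1 hDs
  have hcard : ((Finset.Icc 1 n).card : ℝ) = n := by simp
  have hmain := sum_binomWeight_le_of_sparse_assignment (E := Finset.Icc 1 n)
    (P := fun A => ¬ IsRb (1 / r) (s + 1) A) hp hp1 hr1 ht0 X q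
    (by rwa [hcard]) hA (by rw [hcard]; linarith) (by rw [hcard]; linarith) het
    (by rw [hcard]; linarith)
  rw [hcard] at hmain
  rw [binomProb_eq_one_sub]
  have : (1 / (16 * r) * n * p : ℝ) = n * p / (16 * r) := by ring
  rw [this]
  linarith
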